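/- arXiv:1904.09642 — 3 statements merged into one kernel-verified Lean document; each statement's English description precedes it below -/
import Mathlib

section
/- There exists a real constant $\delta^*$ with $0<\delta^*\leq 1/13$ such that, in the hyperquotient setup with $\delta\leq\delta^*$, with the square form and Rules I and II, the following holds: if $B=\{\beta\}$ and $\beta\in N\cap\square$, then there exists an integer $k_0$ with $1\leq k_0\leq r-1$ such that $\beta\equiv\alpha_{k_0}\pmod{\mathbb{Z}^4}$, $1-\delta<\frac{k_0}{r}<1$, and $\overline{ak_0}+\overline{bk_0}+\overline{ck_0}+\overline{dk_0}=\overline{ek_0}+k_0+r$. -/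
open scoped BigOperators

namespace GapPaper

/-- Least non-negative residue of `n` modulo `r` (for `r > 0`). -/
def res (r n : ℤ) : ℤ := n % r

/-- The lattice `N = ℤ⁴ + ℤ·(1/r)(a,b,c,d)` inside `ℚ⁴`. -/
def latN (r a b c d : ℤ) : Set (Fin 4 → ℚ) :=
  {v | ∃ (j : ℤ) (m : Fin 4 → ℤ), ∀ i,
    v i = ((j * ![a, b, c, d] i : ℤ) : ℚ) / (r : ℚ) + (m i : ℚ)}

/-- The positive orthant `σ`. -/
def orth : Set (Fin 4 → ℚ) := {v | ∀ i, 0 ≤ v i}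

/-- The weight `w(v) = v₁ + v₂ + v₃ + v₄`. -/
def w (v : Fin 4 → ℚ) : ℚ := ∑ i, v i

/-- `v(f)`: the infimum over the monomials `m ∈ S` of their `v`-weights. -/
noncomputable def vf (S : Set (Fin 4 → ℕ)) (v : Fin 4 → ℚ) : ℝ :=
  sInf {x : ℝ | ∃ m ∈ S, x = ∑ i : Fin 4, (m i : ℝ) * ((v i : ℚ) : ℝ)}

/-- `v` is primitive in the lattice `N`. -/
def IsPrim (r a b c d : ℤ) (v : Fin 4 → ℚ) : Prop :=
  ¬ ∃ (n : ℤ) (u : Fin 4 → ℚ), 2 ≤ n ∧ u ∈ latN r a b c d ∧ v = fun i => (n : ℚ) * u i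

/-- The excluded set `{0, e₁, e₂, e₃, e₄}`. -/
def corners : Set (Fin 4 → ℚ) :=
  {v | v = 0 ∨ ∃ i₀ : Fin 4, v = fun i => if i = i₀ then 1 else 0}

/-- Every monomial of `S` has weight `e` for the `μ_r`-action with weights
`(a, b, c, d)`. -/
def WeightCond (r a b c d e : ℤ) (S : Set (Fin 4 → ℕ)) : Prop :=
  ∀ m ∈ S, Int.ModEq r ((m 0 : ℤ) * a + (m 1 : ℤ) * b + (m 2 : ℤ) * c + (m 3 : ℤ) * d) e

/-- Rule I: `B` is a set with at most one element, whose element `β` (if any) is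
primitive and satisfies `1 - δ < w(β) - β(f) < 1`, and every lattice vector in the
orthant other than `β`, `0`, `e₁`, ..., `e₄` satisfies `w(v) - v(f) > 1`. -/
def RuleI (r a b c d : ℤ) (δ : ℝ) (S : Set (Fin 4 → ℕ)) (B : Set (Fin 4 → ℚ)) : Prop :=
  B.Subsingleton ∧ B ⊆ latN r a b c d ∩ orth ∧
    (∀ β ∈ B, IsPrim r a b c d β ∧
      1 - δ < ((w β : ℚ) : ℝ) - vf S β ∧ ((w β : ℚ) : ℝ) - vf S β < 1) ∧
    ∀ v ∈ latN r a b c d ∩ orth, v ∉ B → v ∉ corners → 1 < ((w v : ℚ) : ℝ) - vf S v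

/-- Rule II. -/
def RuleII (r a b c d e : ℤ) : Prop :=
  (Int.gcd a r ∣ Int.gcd e r) ∧ (Int.gcd b r ∣ Int.gcd e r) ∧
  (Int.gcd c r ∣ Int.gcd e r) ∧ (Int.gcd d r ∣ Int.gcd e r) ∧
  Int.gcd a (Int.gcd b r) = 1 ∧ Int.gcd a (Int.gcd c r) = 1 ∧
  Int.gcd a (Int.gcd d r) = 1 ∧ Int.gcd b (Int.gcd c r) = 1 ∧
  Int.gcd b (Int.gcd d r) = 1 ∧ Int.gcd c (Int.gcd d r) = 1 ∧
  Int.ModEq r (a + b + c + d - e) 1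

/-- The vector `α_k = (1/r)(res(ak), res(bk), res(ck), res(dk))`. -/
def alphaK (r a b c d k : ℤ) : Fin 4 → ℚ :=
  fun i => ((res r (![a, b, c, d] i * k) : ℤ) : ℚ) / (r : ℚ)

/-- The unit cube `[0,1]⁴` minus its 16 vertices. -/
def cube : Set (Fin 4 → ℚ) :=
  {v | (∀ i, 0 ≤ v i ∧ v i ≤ 1) ∧ ¬ ∀ i, v i = 0 ∨ v i = 1}

/-- The cA form: `f = xy + g(z,t)` with `g ∈ 𝔪²`. -/
def FormCA (S : Set (Fin 4 → ℕ)) : Prop :=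
  ![1, 1, 0, 0] ∈ S ∧
    ∀ m ∈ S, m ≠ ![1, 1, 0, 0] → m 0 = 0 ∧ m 1 = 0 ∧ 2 ≤ m 2 + m 3

/-- The square form: `f = x² + (terms of order ≥ 2)`. -/
def FormSq (S : Set (Fin 4 → ℕ)) : Prop :=
  ![2, 0, 0, 0] ∈ S ∧ ∀ m ∈ S, 2 ≤ m 0 + m 1 + m 2 + m 3

/-- The odd form: `f = x² + y² + g(z,t)` with `g ∈ 𝔪³`. -/
def FormOdd (S : Set (Fin 4 → ℕ)) : Prop :=
  ![2, 0, 0, 0] ∈ S ∧ ![0, 2, 0, 0] ∈ S ∧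
    ∀ m ∈ S, m ≠ ![2, 0, 0, 0] → m ≠ ![0, 2, 0, 0] →
      m 0 = 0 ∧ m 1 = 0 ∧ 3 ≤ m 2 + m 3

/-- The cD–E form: `f = x² + g(y,z,t)` with `g ∈ 𝔪³`. -/
def FormCDE (S : Set (Fin 4 → ℕ)) : Prop :=
  ![2, 0, 0, 0] ∈ S ∧ ∀ m ∈ S, m ≠ ![2, 0, 0, 0] → m 0 = 0 ∧ 3 ≤ m 1 + m 2 + m 3

theorem dirich (q : Fin 5 → ℝ) (η : ℝ) (hη : 0 < η) :
    ∃ s : ℕ, 1 ≤ s ∧ ∀ i, ∃ k : ℤ, |(s : ℝ) * q i - k| < η := by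
  obtain ⟨K, hK⟩ := exists_nat_one_div_lt hη
  have hK0 : (0 : ℝ) < (K : ℝ) + 1 := by positivity
  let g : ℕ → (Fin 5 → Fin (K + 1)) := fun n i =>
    ⟨⌊Int.fract ((n : ℝ) * q i) * ((K : ℝ) + 1)⌋₊, by
      rw [Nat.floor_lt (mul_nonneg (Int.fract_nonneg _) hK0.le)]
      have := Int.fract_lt_one ((n : ℝ) * q i)
      push_cast
      nlinarith⟩
  have key : ∀ x y : ℕ, x < y → g x = g y →
      ∃ s : ℕ, 1 ≤ s ∧ ∀ i, ∃ k : ℤ, |(s : ℝ) * q i - k| < η := by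
    intro x y hxy h
    refine ⟨y - x, by omega, fun i => ⟨⌊(y : ℝ) * q i⌋ - ⌊(x : ℝ) * q i⌋, ?_⟩⟩
    have h1 : ⌊Int.fract ((x : ℝ) * q i) * ((K : ℝ) + 1)⌋₊
        = ⌊Int.fract ((y : ℝ) * q i) * ((K : ℝ) + 1)⌋₊ := by
      have := congrFun h i
      simpa [g] using this
    have a1 := Nat.floor_le (mul_nonneg (Int.fract_nonneg ((x : ℝ) * q i)) hK0.le)
    have a2 := Nat.lt_floor_add_one (Int.fract ((x : ℝ) * q i) * ((K : ℝ) + 1))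
    have b1 := Nat.floor_le (mul_nonneg (Int.fract_nonneg ((y : ℝ) * q i)) hK0.le)
    have b2 := Nat.lt_floor_add_one (Int.fract ((y : ℝ) * q i) * ((K : ℝ) + 1))
    rw [h1] at a1 a2
    have hab : |(Int.fract ((y : ℝ) * q i) - Int.fract ((x : ℝ) * q i)) * ((K : ℝ) + 1)| < 1 := by
      rw [abs_lt]; constructor <;> nlinarith
    rw [abs_mul, abs_of_pos hK0, ← lt_div_iff₀ hK0] at hab
    have e1 : (((y - x : ℕ) : ℝ)) * q i - ((⌊(y : ℝ) * q i⌋ - ⌊(x : ℝ) * q i⌋ : ℤ) : ℝ)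
        = Int.fract ((y : ℝ) * q i) - Int.fract ((x : ℝ) * q i) := by
      rw [Nat.cast_sub hxy.le]
      simp only [Int.fract]
      push_cast
      ring
    rw [e1]
    exact hab.trans hK
  obtain ⟨x, y, hne, h⟩ := Finite.exists_ne_map_eq_of_infinite g
  rcases lt_or_gt_of_ne hne with h' | h'
  · exact key x y h' h
  · exact key y x h' h.symm

theorem coord (q : ℝ) (h0 : 0 ≤ q) (h1 : q ≤ 1) :
    ∃ η : ℝ, 0 < η ∧ ∀ (s : ℕ) (k : ℤ), |(s : ℝ) * q - k| < η →
      ∀ᶠ x in nhds q, 0 ≤ x → x < 1 → |Int.fract (((s + 1 : ℕ) : ℝ) * x) - x| < 1 / 20 := by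
  have fin : ∀ (s : ℕ) (k : ℤ) (x : ℝ), 0 ≤ ((s : ℝ) + 1) * x - k → ((s : ℝ) + 1) * x - k < 1 →
      |(s : ℝ) * x - k| < 1 / 20 → |Int.fract (((s + 1 : ℕ) : ℝ) * x) - x| < 1 / 20 := by
    intro s k x g0 g1 g2
    have : Int.fract (((s + 1 : ℕ) : ℝ) * x) = ((s : ℝ) + 1) * x - k := by
      rw [Int.fract_eq_iff]
      refine ⟨g0, g1, k, ?_⟩
      push_cast
      ring
    rw [this]
    convert g2 using 2
    ring
  have c1 : ∀ (s : ℕ) (k : ℤ), Continuous (fun x : ℝ => ((s : ℝ) + 1) * x - k) := by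
    intros; fun_prop
  have c2 : ∀ (s : ℕ) (k : ℤ), Continuous (fun x : ℝ => |(s : ℝ) * x - k|) := by
    intros; fun_prop
  rcases eq_or_lt_of_le h0 with hq | hq
  · refine ⟨1 / 20, by norm_num, fun s k hk => ?_⟩
    subst hq
    have hk0 : k = 0 := by
      have : |(k : ℝ)| < 1 := by
        have := hk
        simp at this
        rw [abs_lt] at *
        constructor <;> linarith
      rw [← Int.cast_abs] at this
      have : |k| < 1 := by exact_mod_cast this
      exact Int.abs_lt_one_iff.mp this
    have e1 := (c1 s k).continuousAt.eventually_lt (g := fun _ => (1 : ℝ)) (x₀ := 0)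
      continuousAt_const (by simp [hk0])
    have e2 := (c2 s k).continuousAt.eventually_lt (g := fun _ => (1 / 20 : ℝ)) (x₀ := 0)
      continuousAt_const hk
    filter_upwards [e1, e2] with x f1 f2 g0 g1
    refine fin s k x ?_ f1 f2
    rw [hk0]
    have : (0 : ℝ) ≤ s := by positivity
    push_cast
    nlinarith
  rcases eq_or_lt_of_le h1 with hq1 | hq1
  · refine ⟨1 / 20, by norm_num, fun s k hk => ?_⟩
    subst hq1
    have hk0 : k = s := by
      have : |(((s : ℤ) - k : ℤ) : ℝ)| < 1 := by
        have := hk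
        simp only [mul_one] at this
        push_cast
        linarith
      rw [← Int.cast_abs] at this
      have : |(s : ℤ) - k| < 1 := by exact_mod_cast this
      have := Int.abs_lt_one_iff.mp this
      omega
    have e1 := ContinuousAt.eventually_lt (f := fun _ => (0 : ℝ)) (x₀ := (1 : ℝ))
      continuousAt_const (c1 s k).continuousAt (by simp [hk0])
    have e2 := (c2 s k).continuousAt.eventually_lt (g := fun _ => (1 / 20 : ℝ)) (x₀ := 1)
      continuousAt_const hk
    filter_upwards [e1, e2] with x f1 f2 g0 g1
    refine fin s k x f1.le ?_ f2
    rw [hk0]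
    have : (0 : ℝ) ≤ s := by positivity
    push_cast
    nlinarith
  · refine ⟨min (1 / 20) (min q (1 - q)), by
      refine lt_min (by norm_num) (lt_min hq (by linarith)), fun s k hk => ?_⟩
    obtain ⟨hk1, hk2⟩ := lt_min_iff.mp hk
    obtain ⟨hk2, hk3⟩ := lt_min_iff.mp hk2
    rw [abs_lt] at hk2 hk3
    have e0 := ContinuousAt.eventually_lt (f := fun _ => (0 : ℝ)) (x₀ := q)
      continuousAt_const (c1 s k).continuousAt (by nlinarith)
    have e1 := (c1 s k).continuousAt.eventually_lt (g := fun _ => (1 : ℝ)) (x₀ := q)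
      continuousAt_const (by nlinarith)
    have e2 := (c2 s k).continuousAt.eventually_lt (g := fun _ => (1 / 20 : ℝ)) (x₀ := q)
      continuousAt_const hk1
    filter_upwards [e0, e1, e2] with x f0 f1 f2 g0 g1
    exact fin s k x f0.le f1 f2

/-- Uniform recurrence near the starting point. -/
theorem recur : ∃ L : ℕ, ∀ p : Fin 5 → ℝ, (∀ i, 0 ≤ p i ∧ p i < 1) →
    ∃ l : ℕ, 2 ≤ l ∧ l ≤ L ∧ ∀ i, |Int.fract ((l : ℝ) * p i) - p i| < 1 / 20 := by
  have hc : IsCompact (Set.Icc (0 : Fin 5 → ℝ) 1) := isCompact_Icc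
  have := hc.induction_on (p := fun T => ∃ L : ℕ, ∀ p ∈ T, (∀ i, 0 ≤ p i ∧ p i < 1) →
    ∃ l : ℕ, 2 ≤ l ∧ l ≤ L ∧ ∀ i, |Int.fract ((l : ℝ) * p i) - p i| < 1 / 20)
    ⟨0, by simp⟩ ?_ ?_ ?_
  · obtain ⟨L, hL⟩ := this
    exact ⟨L, fun p hp => hL p ⟨fun i => (hp i).1, fun i => (hp i).2.le⟩ hp⟩
  · rintro s t hst ⟨L, hL⟩
    exact ⟨L, fun p hp => hL p (hst hp)⟩
  · rintro s t ⟨L, hL⟩ ⟨M, hM⟩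
    refine ⟨max L M, ?_⟩
    rintro p (hp | hp) h
    · obtain ⟨l, h1, h2, h3⟩ := hL p hp h
      exact ⟨l, h1, h2.trans (le_max_left _ _), h3⟩
    · obtain ⟨l, h1, h2, h3⟩ := hM p hp h
      exact ⟨l, h1, h2.trans (le_max_right _ _), h3⟩
  · intro q hq
    choose η hη hη' using fun i => coord (q i) (hq.1 i) (hq.2 i)
    obtain ⟨η0, hη0, hle⟩ : ∃ η0 : ℝ, 0 < η0 ∧ ∀ i, η0 ≤ η i := by
      obtain ⟨i0, hi0⟩ := Finite.exists_min η
      exact ⟨η i0, hη i0, hi0⟩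
    obtain ⟨s, hs, hk⟩ := dirich q η0 hη0
    choose k hk using hk
    have ev : ∀ i, ∀ᶠ p in nhds q, 0 ≤ p i → p i < 1 →
        |Int.fract (((s + 1 : ℕ) : ℝ) * p i) - p i| < 1 / 20 := fun i =>
      ((continuous_apply i).tendsto q).eventually (hη' i s (k i) ((hk i).trans_le (hle i)))
    have ev' := Filter.eventually_all.mpr ev
    refine ⟨_, mem_nhdsWithin_of_mem_nhds ev', s + 1, fun p hp h => ⟨s + 1, by omega, le_rfl, fun i => hp i (h i).1 (h i).2⟩⟩

theorem vf_spec (r a b c d e : ℤ) (hr : 0 < r) (S : Set (Fin 4 → ℕ)) (hS : S.Nonempty)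
    (hW : WeightCond r a b c d e S) (v : Fin 4 → ℚ) (hv : v ∈ orth) (j : ℤ) (m : Fin 4 → ℤ)
    (hj : ∀ i, v i = ((j * ![a, b, c, d] i : ℤ) : ℚ) / (r : ℚ) + (m i : ℚ)) :
    (∃ μ ∈ S, vf S v = ∑ i : Fin 4, (μ i : ℝ) * ((v i : ℚ) : ℝ)) ∧
    (∀ μ ∈ S, vf S v ≤ ∑ i : Fin 4, (μ i : ℝ) * ((v i : ℚ) : ℝ)) ∧
    0 ≤ vf S v ∧ ∃ n : ℤ, vf S v = (j : ℝ) * e / r + n := by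
  have hr' : (r : ℝ) ≠ 0 := by exact_mod_cast hr.ne'
  have hvR : ∀ i, ((v i : ℚ) : ℝ) = ((j : ℝ) * (![a, b, c, d] i : ℤ)) / r + m i := by
    intro i; rw [hj i]; push_cast; ring
  have hnn : ∀ μ ∈ S, 0 ≤ ∑ i : Fin 4, (μ i : ℝ) * ((v i : ℚ) : ℝ) := by
    intro μ _
    refine Finset.sum_nonneg fun i _ => mul_nonneg (by positivity) ?_
    exact_mod_cast hv i
  have hint : ∀ μ ∈ S, ∃ n : ℤ, ∑ i : Fin 4, (μ i : ℝ) * ((v i : ℚ) : ℝ) = (j : ℝ) * e / r + n := by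
    intro μ hμ
    obtain ⟨q, hq⟩ := (hW μ hμ).symm.dvd
    have hq' : (μ 0 : ℝ) * a + μ 1 * b + μ 2 * c + μ 3 * d - e = r * q := by exact_mod_cast hq
    refine ⟨j * q + ∑ i, (μ i : ℤ) * m i, ?_⟩
    simp only [Fin.sum_univ_four, hvR]
    simp
    field_simp
    linear_combination (j : ℝ) * hq'
  obtain ⟨N, ⟨μ, hμ, hμN⟩, hmin⟩ := Int.exists_least_of_bdd
    (P := fun n : ℤ => ∃ μ ∈ S, ∑ i : Fin 4, (μ i : ℝ) * ((v i : ℚ) : ℝ) = (j : ℝ) * e / r + n)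
    ⟨⌊-((j : ℝ) * e / r)⌋, by
      rintro z ⟨μ, hμ, h⟩
      have := hnn μ hμ
      rw [h] at this
      have h2 := Int.floor_le (-((j : ℝ) * e / r))
      have : ((⌊-((j : ℝ) * e / r)⌋ : ℤ) : ℝ) ≤ z := by linarith
      exact_mod_cast this⟩
    (by
      obtain ⟨μ, hμ⟩ := hS
      obtain ⟨n, hn⟩ := hint μ hμ
      exact ⟨n, μ, hμ, hn⟩)
  have hleast : IsLeast {x : ℝ | ∃ m ∈ S, x = ∑ i : Fin 4, (m i : ℝ) * ((v i : ℚ) : ℝ)}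
      (∑ i : Fin 4, (μ i : ℝ) * ((v i : ℚ) : ℝ)) := by
    refine ⟨⟨μ, hμ, rfl⟩, ?_⟩
    rintro x ⟨ν, hν, rfl⟩
    obtain ⟨n, hn⟩ := hint ν hν
    have := hmin n ⟨ν, hν, hn⟩
    rw [hn, hμN]
    have : (N : ℝ) ≤ n := by exact_mod_cast this
    linarith
  have heq : vf S v = ∑ i : Fin 4, (μ i : ℝ) * ((v i : ℚ) : ℝ) := hleast.csInf_eq
  refine ⟨⟨μ, hμ, heq⟩, fun ν hν => heq ▸ hleast.2 ⟨ν, hν, rfl⟩, heq ▸ hnn μ hμ, N, heq.trans hμN⟩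

theorem w_spec (r a b c d e : ℤ) (hr : 0 < r) (h2 : Int.ModEq r (a + b + c + d - e) 1)
    (v : Fin 4 → ℚ) (j : ℤ) (m : Fin 4 → ℤ)
    (hj : ∀ i, v i = ((j * ![a, b, c, d] i : ℤ) : ℚ) / (r : ℚ) + (m i : ℚ)) :
    ∃ n : ℤ, ((w v : ℚ) : ℝ) = (j : ℝ) / r + (j : ℝ) * e / r + n := by
  have hr' : (r : ℝ) ≠ 0 := by exact_mod_cast hr.ne'
  obtain ⟨q, hq⟩ := h2.symm.dvd
  have hq' : (a : ℝ) + b + c + d - e - 1 = r * q := by exact_mod_cast hq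
  refine ⟨j * q + ∑ i, m i, ?_⟩
  simp only [w, Fin.sum_univ_four, hj]
  simp
  field_simp
  linear_combination (j : ℝ) * hq'

theorem res_fract (r : ℤ) (hr : 0 < r) (x j k0 n m : ℤ) (hk : k0 = j + n * r) :
    ((res r (x * k0) : ℤ) : ℚ) / r = Int.fract (((j * x : ℤ) : ℚ) / r + (m : ℚ)) := by
  have hr' : (0 : ℚ) < r := by exact_mod_cast hr
  symm
  rw [Int.fract_eq_iff]
  have h1 := Int.emod_nonneg (x * k0) hr.ne'
  have h2 := Int.emod_lt_of_pos (x * k0) hr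
  have h3 := Int.mul_ediv_add_emod (x * k0) r
  unfold res
  refine ⟨?_, ?_, x * k0 / r + m - n * x, ?_⟩
  · have : (0 : ℚ) ≤ ((x * k0 % r : ℤ) : ℚ) := by exact_mod_cast h1
    positivity
  · rw [div_lt_one hr']
    exact_mod_cast h2
  · have h3' : (r : ℚ) * ((x * k0 / r : ℤ) : ℚ) + ((x * k0 % r : ℤ) : ℚ) = x * k0 := by
      exact_mod_cast h3
    have hk' : (k0 : ℚ) = j + n * r := by exact_mod_cast hk
    rw [hk'] at h3'
    push_cast
    field_simp
    linear_combination (-1 : ℚ) * h3'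

theorem corner_int (v : Fin 4 → ℚ) (h : v ∈ corners) : ∀ i, v i = 0 ∨ v i = 1 := by
  rcases h with h | ⟨i0, h⟩
  · intro i; left; simp [h]
  · intro i
    rw [h]
    by_cases hi : i = i0
    · right; simp [hi]
    · left; simp [hi]

set_option maxHeartbeats 2000000

/-- Proposition (x²), part (3), in the square case. -/
theorem statement13 :
    ∃ δstar : ℝ, 0 < δstar ∧ δstar ≤ 1 / 13 ∧
      ∀ (r : ℤ) (δ : ℝ) (a b c d e : ℤ) (S : Set (Fin 4 → ℕ)) (B : Set (Fin 4 → ℚ)),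
        13 < r → 0 < δ → δ ≤ δstar →
        WeightCond r a b c d e S → RuleI r a b c d δ S B → RuleII r a b c d e →
        FormSq S →
        ∀ β, B = {β} → β ∈ latN r a b c d ∩ cube →
        ∃ k0 : ℤ, 1 ≤ k0 ∧ k0 ≤ r - 1 ∧
          (∃ m : Fin 4 → ℤ, ∀ i, β i = alphaK r a b c d k0 i + (m i : ℚ)) ∧
          1 - δ < (k0 : ℝ) / (r : ℝ) ∧ (k0 : ℝ) / (r : ℝ) < 1 ∧
          res r (a * k0) + res r (b * k0) + res r (c * k0) + res r (d * k0)
            = res r (e * k0) + k0 + r := by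
  obtain ⟨L, hL⟩ := recur
  have hL0 : (0 : ℝ) ≤ L := by positivity
  refine ⟨1 / (2 * L + 13), by positivity, ?_, ?_⟩
  · rw [div_le_div_iff₀ (by positivity) (by norm_num)]
    linarith
  intro r δ a b c d e S B hr hδ0 hδ hW hI hII hF β hB hβ
  subst hB
  obtain ⟨-, hBsub, hB2, hB3⟩ := hI
  obtain ⟨-, hφ1, hφ2⟩ := hB2 β rfl
  have hβo : β ∈ orth := (hBsub rfl).2
  have hmod : Int.ModEq r (a + b + c + d - e) 1 := hII.2.2.2.2.2.2.2.2.2.2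
  obtain ⟨⟨j, m, hj⟩, hcube, hnv⟩ := hβ
  have hr0 : 0 < r := by omega
  have hrR : (0 : ℝ) < r := by exact_mod_cast hr0
  have hrQ : (0 : ℚ) < r := by exact_mod_cast hr0
  have hSne : S.Nonempty := ⟨_, hF.1⟩
  obtain ⟨-, hle, ht0, n1, hn1⟩ := vf_spec r a b c d e hr0 S hSne hW β hβo j m hj
  obtain ⟨n2, hn2⟩ := w_spec r a b c d e hr0 hmod β j m hj
  have ht2 : vf S β ≤ 2 * ((β 0 : ℚ) : ℝ) := by
    have := hle _ hF.1
    simpa [Fin.sum_univ_four] using this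
  have hδ1 : δ ≤ 1 / 13 := hδ.trans (by
    rw [div_le_div_iff₀ (by positivity) (by norm_num)]
    linarith)
  obtain ⟨k0, hk0⟩ : ∃ k0 : ℤ, k0 = j + (n2 - n1) * r := ⟨_, rfl⟩
  obtain ⟨φ, hφ⟩ : ∃ φ : ℝ, φ = (k0 : ℝ) / r := ⟨_, rfl⟩
  have hφj : φ = (j : ℝ) / r + (n2 - n1) := by
    rw [hφ, hk0]; push_cast; field_simp
  have hφw : ((w β : ℚ) : ℝ) - vf S β = φ := by
    rw [hn1, hn2, hφj]; ring
  rw [hφw] at hφ1 hφ2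
  have hφ0 : 0 < φ := by linarith
  have hk1 : 0 < k0 := by
    have : (0 : ℝ) < k0 := by
      rw [hφ] at hφ0
      rwa [lt_div_iff₀ hrR, zero_mul] at hφ0
    exact_mod_cast this
  have hk2 : k0 < r := by
    have : (k0 : ℝ) < r := by
      rw [hφ] at hφ2
      rwa [div_lt_one hrR] at hφ2
    exact_mod_cast this
  have hA : ∀ i, alphaK r a b c d k0 i = Int.fract (β i) := by
    intro i
    rw [hj i]
    exact res_fract r hr0 _ j k0 (n2 - n1) (m i) hk0
  refine ⟨k0, by omega, by omega, ⟨fun i => ⌊β i⌋, fun i => ?_⟩, by rw [← hφ]; exact hφ1,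
    by rw [← hφ]; exact hφ2, ?_⟩
  · rw [hA]; exact (Int.fract_add_floor (β i)).symm
  -- the residue of `e k0`
  obtain ⟨X, hX⟩ : ∃ X : ℝ, X = ((res r (e * k0) : ℤ) : ℝ) / r := ⟨_, rfl⟩
  have hXf := res_fract r hr0 e j k0 (n2 - n1) n1 hk0
  have hXQ : X = (((res r (e * k0) : ℤ) : ℚ) / r : ℚ) := by rw [hX]; push_cast; rfl
  have hX0 : 0 ≤ X := by
    rw [hXQ, hXf]; exact_mod_cast Int.fract_nonneg _
  have hX1 : X < 1 := by
    rw [hXQ, hXf]; exact_mod_cast Int.fract_lt_one _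
  obtain ⟨n3, hn3⟩ : ∃ n3 : ℤ, vf S β = X + n3 := by
    refine ⟨⌊((j * e : ℤ) : ℚ) / r + (n1 : ℚ)⌋, ?_⟩
    have h := Int.fract_add_floor (((j * e : ℤ) : ℚ) / r + (n1 : ℚ))
    have h' := congrArg (fun x : ℚ => (x : ℝ)) h
    rw [hXQ, hXf, hn1]
    push_cast at h' ⊢
    linarith
  have goal_of : (∑ i, ((Int.fract (β i) : ℚ) : ℝ)) = X + φ + 1 →
      res r (a * k0) + res r (b * k0) + res r (c * k0) + res r (d * k0)
        = res r (e * k0) + k0 + r := by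
    intro h
    simp only [← hA, Fin.sum_univ_four, alphaK, hX, hφ] at h
    simp at h
    field_simp at h
    exact_mod_cast h
  have hwβ : ((w β : ℚ) : ℝ) = ∑ i, ((β i : ℚ) : ℝ) := by
    simp [w]
  have hsum : (∑ i, ((β i : ℚ) : ℝ)) = φ + vf S β := by linarith
  by_cases hall : ∀ i, β i < 1
  · have hfr : ∀ i, Int.fract (β i) = β i := fun i =>
      Int.fract_eq_self.mpr ⟨hβo i, hall i⟩
    have hb0 : ((β 0 : ℚ) : ℝ) < 1 := by exact_mod_cast hall 0
    by_cases h1 : n3 = 1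
    · apply goal_of
      simp only [hfr]
      rw [hsum, hn3, h1]
      push_cast; ring
    exfalso
    have h3a : n3 < 2 := by
      have : (n3 : ℝ) < 2 := by linarith
      exact_mod_cast this
    have h3b : -1 < n3 := by
      have : (-1 : ℝ) < n3 := by linarith
      exact_mod_cast this
    have h3 : n3 = 0 := by omega
    have ht1 : vf S β < 1 := by rw [hn3, h3]; simpa using hX1
    obtain ⟨l, hl2, hlL, hl⟩ := hL ![((β 0 : ℚ) : ℝ), ((β 1 : ℚ) : ℝ), ((β 2 : ℚ) : ℝ),
      ((β 3 : ℚ) : ℝ), vf S β] (by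
        have hb : ∀ i, (0 : ℝ) ≤ ((β i : ℚ) : ℝ) ∧ ((β i : ℚ) : ℝ) < 1 := fun i =>
          ⟨by exact_mod_cast hβo i, by exact_mod_cast hall i⟩
        intro i
        fin_cases i
        · exact hb 0
        · exact hb 1
        · exact hb 2
        · exact hb 3
        · exact ⟨ht0, ht1⟩)
    have l0 := hl 0
    have l1 := hl 1
    have l2 := hl 2
    have l3 := hl 3
    have l4 := hl 4
    simp at l0 l1 l2 l3 l4
    rw [abs_lt] at l0 l1 l2 l3 l4
    obtain ⟨ε, hε⟩ : ∃ ε : ℝ, ε = 1 - φ := ⟨_, rfl⟩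
    have hε0 : 0 < ε := by linarith
    have hl2R : (2 : ℝ) ≤ l := by exact_mod_cast hl2
    have hlLR : (l : ℝ) ≤ L := by exact_mod_cast hlL
    have hlε : (l : ℝ) * ε < 1 / 2 := by
      have h1 : ε < 1 / (2 * L + 13) := by linarith
      have h2 : ε * (2 * L + 13) < 1 := by
        rwa [lt_div_iff₀ (by positivity)] at h1
      nlinarith
    have hle0 : 0 < (l : ℝ) * ε := by positivity
    have hle1 : ε < (l : ℝ) * ε := lt_mul_of_one_lt_left hε0 (by linarith)
    -- the vector v
    obtain ⟨v, hv⟩ : ∃ v : Fin 4 → ℚ, v = fun i => Int.fract ((l : ℚ) * β i) := ⟨_, rfl⟩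
    have hvo : v ∈ orth := by
      intro i; rw [hv]; exact Int.fract_nonneg _
    have hvj : ∀ i, v i = ((((l : ℤ) * j) * ![a, b, c, d] i : ℤ) : ℚ) / (r : ℚ)
        + (((fun i => (l : ℤ) * m i - ⌊(l : ℚ) * β i⌋) i : ℤ) : ℚ) := by
      intro i
      rw [hv]
      simp only [Int.fract]
      push_cast
      have := hj i
      push_cast at this
      linear_combination (l : ℚ) * this
    obtain ⟨⟨μ, -, hμ⟩, -, hv0, n4, hn4⟩ := vf_spec r a b c d e hr0 S hSne hW v hvo _ _ hvj
    obtain ⟨n5, hn5⟩ := w_spec r a b c d e hr0 hmod v _ _ hvj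
    -- value of v
    obtain ⟨M, hM⟩ : ∃ M : ℤ, ((w v : ℚ) : ℝ) - vf S v = M - l * ε := by
      refine ⟨n5 - n4 + l - l * (n2 - n1), ?_⟩
      have hjr : (j : ℝ) / r = 1 - ε - (n2 - n1) := by linarith
      have : ((w v : ℚ) : ℝ) - vf S v = l * ((j : ℝ) / r) + n5 - n4 := by
        rw [hn4, hn5]; push_cast; ring
      rw [this, hjr]; push_cast; ring
    have hvB : v ∉ ({β} : Set (Fin 4 → ℚ)) := by
      intro h
      have h : v = β := h
      rw [h, hφw] at hM
      have h1 : (1 : ℝ) - M = ε - l * ε := by linarith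
      have h2 : (0 : ℝ) < (M : ℝ) - 1 := by linarith
      have h3 : (M : ℝ) - 1 < 1 := by linarith
      have h2' : 0 < M - 1 := by exact_mod_cast h2
      have h3' : M - 1 < 1 := by exact_mod_cast h3
      omega
    have hvc : v ∉ corners := by
      intro h
      have hc := corner_int v h
      have hz : ∀ i, ∃ z : ℤ, v i = z := fun i => by
        rcases hc i with h | h
        · exact ⟨0, by simp [h]⟩
        · exact ⟨1, by simp [h]⟩
      choose z hz using hz
      have e1 : ((w v : ℚ) : ℝ) - vf S v = ((∑ i, z i - ∑ i, (μ i : ℤ) * z i : ℤ) : ℝ) := by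
        rw [hμ]
        simp [w, hz]
      rw [e1] at hM
      have h2 : (0 : ℝ) < ((M - (∑ i, z i - ∑ i, (μ i : ℤ) * z i) : ℤ) : ℝ) := by
        rw [Int.cast_sub]; linarith
      have h3 : ((M - (∑ i, z i - ∑ i, (μ i : ℤ) * z i) : ℤ) : ℝ) < 1 := by
        rw [Int.cast_sub]; linarith
      have h2' : 0 < M - (∑ i, z i - ∑ i, (μ i : ℤ) * z i) := by exact_mod_cast h2
      have h3' : M - (∑ i, z i - ∑ i, (μ i : ℤ) * z i) < 1 := by exact_mod_cast h3
      omega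
    have hbig := hB3 v ⟨⟨_, _, hvj⟩, hvo⟩ hvB hvc
    have hM2 : 2 ≤ M := by
      have : (1 : ℝ) < M := by linarith
      have : 1 < M := by exact_mod_cast this
      omega
    have hM2R : (2 : ℝ) ≤ M := by exact_mod_cast hM2
    have hvt : Int.fract ((l : ℝ) * vf S β) ≤ vf S v := by
      have : vf S v = (l : ℝ) * vf S β + ((n4 - l * n1 : ℤ) : ℝ) := by
        rw [hn4, hn1]; push_cast; ring
      have h2 : Int.fract ((l : ℝ) * vf S β) = Int.fract (vf S v) := by
        rw [this, Int.fract_add_intCast]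
      rw [h2]
      have := Int.floor_nonneg.mpr hv0
      have h3 : (0 : ℝ) ≤ (⌊vf S v⌋ : ℤ) := by exact_mod_cast this
      have := Int.fract_add_floor (vf S v)
      linarith
    have hcast : ∀ i, ((v i : ℚ) : ℝ) = Int.fract ((l : ℝ) * ((β i : ℚ) : ℝ)) := by
      intro i
      rw [hv]
      simp only
      rw [Rat.cast_fract]
      push_cast
      rfl
    have hwv : ((w v : ℚ) : ℝ) = ∑ i, Int.fract ((l : ℝ) * ((β i : ℚ) : ℝ)) := by
      simp [w, hcast]
    rw [Fin.sum_univ_four] at hwv hsum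
    linarith [l0.2, l1.2, l2.2, l3.2, l4.1]
  · push Not at hall
    obtain ⟨i0, hi0⟩ := hall
    have hi1 : β i0 = 1 := le_antisymm (hcube i0).2 hi0
    obtain ⟨A, hAd⟩ : ∃ A : Fin 4 → ℚ, A = fun i => Int.fract (β i) := ⟨_, rfl⟩
    have hAo : A ∈ orth := by
      intro i; rw [hAd]; exact Int.fract_nonneg _
    have hAj : ∀ i, A i = ((j * ![a, b, c, d] i : ℤ) : ℚ) / (r : ℚ)
        + (((fun i => m i - ⌊β i⌋) i : ℤ) : ℚ) := by
      intro i
      rw [hAd]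
      simp only [Int.fract]
      push_cast
      have := hj i
      push_cast at this
      linear_combination this
    have hA0 : A i0 = 0 := by rw [hAd]; simp [hi1]
    have hAB : A ∉ ({β} : Set (Fin 4 → ℚ)) := by
      intro h
      have h : A = β := h
      rw [h, hi1] at hA0
      norm_num at hA0
    have hAc : A ∉ corners := by
      intro h
      apply hnv
      intro i
      have hlt : A i < 1 := by rw [hAd]; exact Int.fract_lt_one _
      rcases corner_int A h i with h | h
      · rw [hAd] at h
        by_cases h1 : β i = 1
        · exact Or.inr h1
        · left
          rw [← h]
          exact (Int.fract_eq_self.mpr ⟨hβo i, lt_of_le_of_ne (hcube i).2 h1⟩).symm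
      · linarith
    have hbig := hB3 A ⟨⟨_, _, hAj⟩, hAo⟩ hAB hAc
    obtain ⟨-, -, hAf0, n4, hn4⟩ := vf_spec r a b c d e hr0 S hSne hW A hAo _ _ hAj
    obtain ⟨n5, hn5⟩ := w_spec r a b c d e hr0 hmod A _ _ hAj
    obtain ⟨M, hM⟩ : ∃ M : ℤ, ((w A : ℚ) : ℝ) - vf S A = M + φ := by
      refine ⟨n5 - n4 - (n2 - n1), ?_⟩
      rw [hn4, hn5, hφj]; push_cast; ring
    have hM1 : 1 ≤ M := by
      have : (0 : ℝ) < M := by linarith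
      have : 0 < M := by exact_mod_cast this
      omega
    have hM1R : (1 : ℝ) ≤ M := by exact_mod_cast hM1
    have hwA : ((w A : ℚ) : ℝ) ≤ ((w β : ℚ) : ℝ) - 1 := by
      have : w A ≤ w β - 1 := by
        have h1 : ∑ i, (β i - A i) ≥ β i0 - A i0 := by
          refine Finset.single_le_sum (f := fun i => β i - A i) (fun i _ => ?_) (Finset.mem_univ i0)
          rw [hAd]
          simp only [Int.fract]
          have := Int.floor_nonneg.mpr (hβo i)
          have : (0 : ℚ) ≤ (⌊β i⌋ : ℤ) := by exact_mod_cast this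
          linarith
        rw [Finset.sum_sub_distrib, hi1, hA0] at h1
        unfold w
        linarith
      exact_mod_cast this
    have hb0 : ((β 0 : ℚ) : ℝ) ≤ 1 := by exact_mod_cast (hcube 0).2
    have ht : vf S β = 2 := by linarith
    have hn32 : n3 = 2 := by
      have h1 : (n3 : ℝ) < 3 := by linarith
      have h2 : (1 : ℝ) < n3 := by linarith
      have h1' : n3 < 3 := by exact_mod_cast h1
      have h2' : 1 < n3 := by exact_mod_cast h2
      omega
    have hXz : X = 0 := by
      rw [hn32] at hn3; push_cast at hn3; linarith
    apply goal_of
    have hwA' : ((w A : ℚ) : ℝ) = ∑ i, ((Int.fract (β i) : ℚ) : ℝ) := by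
      rw [hAd]; simp [w]
    rw [← hwA']
    linarith

end GapPaper
end

section
/- There exists a real constant $\delta^*$ with $0<\delta^*\leq 1/13$ such that, in the hyperquotient setup with $\delta\leq\delta^*$, with the square form and Rules I and II, for every integer $k$ with $1\leq k\leq r-1$ one has $\overline{ak}+\overline{bk}+\overline{ck}+\overline{dk}=\overline{ek}+k+r$. -/
open scoped BigOperators

namespace GapPaper

/-- Scaling constant: interval end points are stored as multiples of `1 / QQ`. -/
def QQ : ℕ := 24504480000

/-- Exhaustive interval search: variables `x₁,…,x₄` confined to `[lᵢ/QQ, hᵢ/QQ)`, refined by the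
values of `⌊2 m x₁⌋, ⌊m x₂⌋, ⌊m x₃⌋, ⌊m x₄⌋`. -/
def chk (c : ℕ) : ℕ → ℕ → ℕ → ℕ → ℕ → ℕ → ℕ → ℕ → ℕ → ℕ → Bool
  | 0, _, _, _, _, _, _, _, _, _ => false
  | fuel + 1, m, l1, h1, l2, h2, l3, h3, l4, h4 =>
    Nat.ble (h1 + c * QQ + QQ / 1000) (l2 + l3 + l4) ||
    Nat.ble (h2 + h3 + h4) (l1 + c * QQ) ||
    Nat.ble h3 l2 || Nat.ble h4 l3 ||
    (List.range (2 * m)).all fun q1 =>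
      Nat.ble (min h1 (((q1 + 1) * QQ + 2 * m - 1) / (2 * m))) (max l1 (q1 * QQ / (2 * m))) ||
      (List.range m).all fun q2 =>
        Nat.ble (min h2 (((q2 + 1) * QQ + m - 1) / m)) (max l2 (q2 * QQ / m)) ||
        (List.range m).all fun q3 =>
          Nat.ble (min h3 (((q3 + 1) * QQ + m - 1) / m)) (max l3 (q3 * QQ / m)) ||
          Nat.ble (q1 + c * m) (q1 / 2 + q2 + q3) ||
          (let q4 := q1 + c * m - (q1 / 2 + q2 + q3 + 1)
           Nat.ble (min h4 (((q4 + 1) * QQ + m - 1) / m)) (max l4 (q4 * QQ / m)) ||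
           chk c fuel (m + 1)
            (max l1 (q1 * QQ / (2 * m))) (min h1 (((q1 + 1) * QQ + 2 * m - 1) / (2 * m)))
            (max l2 (q2 * QQ / m)) (min h2 (((q2 + 1) * QQ + m - 1) / m))
            (max l3 (q3 * QQ / m)) (min h3 (((q3 + 1) * QQ + m - 1) / m))
            (max l4 (q4 * QQ / m)) (min h4 (((q4 + 1) * QQ + m - 1) / m)))

lemma ref_lo {r X m l : ℕ} (hm : 0 < m) (h : l * r ≤ QQ * X) :
    (max l ((m * X / r) * QQ / m)) * r ≤ QQ * X := by
  rcases le_total l ((m * X / r) * QQ / m) with h' | h'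
  · rw [max_eq_right h']
    have h1 : (m * X / r) * QQ / m * m ≤ (m * X / r) * QQ := Nat.div_mul_le_self _ _
    have h2 : m * X / r * r ≤ m * X := Nat.div_mul_le_self _ _
    apply Nat.le_of_mul_le_mul_left _ hm
    calc m * ((m * X / r) * QQ / m * r) = ((m * X / r) * QQ / m * m) * r := by ring
      _ ≤ ((m * X / r) * QQ) * r := Nat.mul_le_mul_right _ h1
      _ = (m * X / r * r) * QQ := by ring
      _ ≤ (m * X) * QQ := Nat.mul_le_mul_right _ h2
      _ = m * (QQ * X) := by ring
  · rwa [max_eq_left h']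

lemma ref_hi {r X m u : ℕ} (hr : 0 < r) (hm : 0 < m) (h : QQ * X < u * r) :
    QQ * X < (min u (((m * X / r + 1) * QQ + m - 1) / m)) * r := by
  rcases le_total u (((m * X / r + 1) * QQ + m - 1) / m) with h' | h'
  · rwa [min_eq_left h']
  · rw [min_eq_right h']
    set q := m * X / r with hq
    set z := ((q + 1) * QQ + m - 1) / m with hz
    have h1 : (q + 1) * QQ ≤ m * z := by
      have := Nat.lt_mul_div_succ ((q + 1) * QQ + m - 1) hm
      rw [← hz] at this
      have e : m * (z + 1) = m * z + m := by ring
      omega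
    have h2 : m * X < (q + 1) * r := by
      have := Nat.lt_mul_div_succ (m * X) hr
      rw [← hq] at this
      linarith
    have hQ : 0 < QQ := by norm_num [QQ]
    apply Nat.lt_of_mul_lt_mul_left (a := m)
    calc m * (QQ * X) = QQ * (m * X) := by ring
      _ < QQ * ((q + 1) * r) := Nat.mul_lt_mul_of_pos_left h2 hQ
      _ = ((q + 1) * QQ) * r := by ring
      _ ≤ (m * z) * r := Nat.mul_le_mul_right _ h1
      _ = m * (z * r) := by ring

lemma ne_ble {l h r Y : ℕ} (h1 : l * r ≤ Y) (h2 : Y < h * r) : Nat.ble h l = false := by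
  by_contra hc
  have : Nat.ble h l = true := by simpa using hc
  have := Nat.le_of_ble_eq_true this
  have := Nat.mul_le_mul_right r this
  omega

lemma chk_sound (c r A B C D s : ℕ) (hr : 0 < r) (hA : A < r) (hB : B < r) (hC : C < r)
    (hBC : B ≤ C) (hCD : C ≤ D) (hsr : 1000 * s < r) (hsum : B + C + D = A + c * r + s) :
    ∀ (fuel m : ℕ), 0 < m → ∀ (l1 h1 l2 h2 l3 h3 l4 h4 : ℕ),
      (∀ j, m ≤ j → j < m + fuel →
        (2 * j * A / r) / 2 + j * B / r + j * C / r + j * D / r + 1 = 2 * j * A / r + c * j) →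
      l1 * r ≤ QQ * A → QQ * A < h1 * r → l2 * r ≤ QQ * B → QQ * B < h2 * r →
      l3 * r ≤ QQ * C → QQ * C < h3 * r → l4 * r ≤ QQ * D → QQ * D < h4 * r →
      chk c fuel m l1 h1 l2 h2 l3 h3 l4 h4 = true → False := by
  intro fuel
  induction fuel with
  | zero => intro m _ l1 h1 l2 h2 l3 h3 l4 h4 _ _ _ _ _ _ _ _ _ h; simp [chk] at h
  | succ fuel ih =>
    intro m hm l1 h1 l2 h2 l3 h3 l4 h4 H a1 b1 a2 b2 a3 b3 a4 b4 h
    rw [chk] at h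
    have hQ : 0 < QQ := by norm_num [QQ]
    have n1 : Nat.ble (h1 + c * QQ + QQ / 1000) (l2 + l3 + l4) = false := by
      have e : QQ * (B + C + D) < (h1 + c * QQ + QQ / 1000) * r := by
        rw [hsum]
        have : QQ * s ≤ QQ / 1000 * r := by
          have : QQ = QQ / 1000 * 1000 := by norm_num [QQ]
          calc QQ * s = QQ / 1000 * (1000 * s) := by rw [← mul_assoc, ← this]
            _ ≤ _ := Nat.mul_le_mul_left _ hsr.le
        nlinarith
      exact ne_ble (Y := QQ * (B + C + D)) (by nlinarith) e
    have n2 : Nat.ble (h2 + h3 + h4) (l1 + c * QQ) = false := by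
      refine ne_ble (r := r) (Y := QQ * (B + C + D)) ?_ (by nlinarith)
      rw [hsum]
      have : 0 ≤ QQ * s := Nat.zero_le _
      nlinarith
    have n4 : Nat.ble h3 l2 = false := ne_ble (a2.trans (Nat.mul_le_mul_left _ hBC)) b3
    have n5 : Nat.ble h4 l3 = false := ne_ble (a3.trans (Nat.mul_le_mul_left _ hCD)) b4
    have q1lt : 2 * m * A / r < 2 * m := by
      rw [Nat.div_lt_iff_lt_mul hr]
      exact Nat.mul_lt_mul_of_pos_left hA (by omega)
    have q2lt : m * B / r < m := by
      rw [Nat.div_lt_iff_lt_mul hr]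
      exact Nat.mul_lt_mul_of_pos_left hB (by omega)
    have q3lt : m * C / r < m := by
      rw [Nat.div_lt_iff_lt_mul hr]
      exact Nat.mul_lt_mul_of_pos_left hC (by omega)
    have hm2 : 0 < 2 * m := by omega
    have A1 := ref_lo (r := r) hm2 a1
    have A2 := ref_lo (r := r) hm a2
    have A3 := ref_lo (r := r) hm a3
    have A4 := ref_lo (r := r) hm a4
    have B1 := ref_hi hr hm2 b1
    have B2 := ref_hi hr hm b2
    have B3 := ref_hi hr hm b3
    have B4 := ref_hi hr hm b4
    have hH := H m le_rfl (by omega)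
    have q4 : 2 * m * A / r + c * m - (2 * m * A / r / 2 + m * B / r + m * C / r + 1)
        = m * D / r :=
      Nat.sub_eq_of_eq_add (by linarith)
    have n3 : Nat.ble (2 * m * A / r + c * m) (2 * m * A / r / 2 + m * B / r + m * C / r)
        = false := by
      by_contra hc
      have := Nat.le_of_ble_eq_true (by simpa using hc)
      rw [← hH] at this
      exact absurd this (Nat.not_le.mpr (Nat.lt_succ_of_le (Nat.le_add_right _ _)))
    rw [n1, n2, n4, n5, Bool.false_or, Bool.false_or, Bool.false_or, Bool.false_or, List.all_eq_true] at h
    have h := h _ (List.mem_range.2 q1lt)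
    rw [ne_ble A1 B1, Bool.false_or, List.all_eq_true] at h
    have h := h _ (List.mem_range.2 q2lt)
    rw [ne_ble A2 B2, Bool.false_or, List.all_eq_true] at h
    have h := h _ (List.mem_range.2 q3lt)
    rw [ne_ble A3 B3, Bool.false_or, n3, Bool.false_or] at h
    simp only [q4] at h
    rw [ne_ble A4 B4, Bool.false_or] at h
    exact ih (m + 1) (by omega) _ _ _ _ _ _ _ _ (fun j hj1 hj2 => H j (by omega) (by omega))
      A1 B1 A2 B2 A3 B3 A4 B4 h

lemma chk_two : chk 2 20 2 0 QQ 0 QQ 0 QQ 0 QQ = true := by decide +kernel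

lemma chk_one : chk 1 20 2 12252240000 QQ 0 QQ 0 QQ 0 QQ = true := by decide +kernel

/-- The key numerical lemma, ordered case. -/
lemma core_ord (c r A B C D s : ℕ) (hc : (c = 1 ∧ r ≤ 2 * A) ∨ c = 2) (hr : 0 < r) (hA : A < r) (hB : B < r)
    (hC : C < r) (hD : D < r)
    (hBC : B ≤ C) (hCD : C ≤ D) (hsr : 1000 * s < r) (hsum : B + C + D = A + c * r + s)
    (H : ∀ j, 2 ≤ j → j < 22 →
        (2 * j * A / r) / 2 + j * B / r + j * C / r + j * D / r + 1 = 2 * j * A / r + c * j) :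
    False := by
  have hQ : 0 < QQ := by norm_num [QQ]
  have key : ∀ l : ℕ, l * r ≤ QQ * A → chk c 20 2 l QQ 0 QQ 0 QQ 0 QQ = true → False :=
    fun l hl h => chk_sound c r A B C D s hr hA hB hC hBC hCD hsr hsum 20 2 (by norm_num)
      l QQ 0 QQ 0 QQ 0 QQ H hl (Nat.mul_lt_mul_of_pos_left hA hQ)
      (by simp) (Nat.mul_lt_mul_of_pos_left hB hQ) (by simp) (Nat.mul_lt_mul_of_pos_left hC hQ)
      (by simp) (Nat.mul_lt_mul_of_pos_left hD hQ) h
  rcases hc with ⟨rfl, hA2⟩ | rfl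
  · refine key 12252240000 ?_ chk_one
    have : QQ = 12252240000 * 2 := by norm_num [QQ]
    calc 12252240000 * r ≤ 12252240000 * (2 * A) := Nat.mul_le_mul_left _ hA2
      _ = QQ * A := by rw [← mul_assoc, ← this]
  · exact key 0 (by simp) chk_two

/-- The key numerical lemma. -/
lemma core (c r A B C D s : ℕ) (hc : (c = 1 ∧ r ≤ 2 * A) ∨ c = 2) (hr : 0 < r) (hA : A < r)
    (hB : B < r) (hC : C < r) (hD : D < r)
    (hsr : 1000 * s < r) (hsum : B + C + D = A + c * r + s)
    (H : ∀ j, 2 ≤ j → j < 22 →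
        (2 * j * A / r) / 2 + j * B / r + j * C / r + j * D / r + 1 = 2 * j * A / r + c * j) :
    False := by
  have key := fun X Y Z hX hY hZ hXY hYZ => core_ord c r A X Y Z s hc hr hA hX hY hZ hXY hYZ hsr
  rcases le_total B C with h1 | h1 <;> rcases le_total C D with h2 | h2 <;>
    rcases le_total B D with h3 | h3
  · exact key B C D hB hC hD h1 h2 hsum H
  · exact key B C D hB hC hD h1 h2 hsum H
  · exact key B D C hB hD hC h3 h2 (by linarith) fun j a b => by linarith [H j a b]
  · exact key D B C hD hB hC h3 h1 (by linarith) fun j a b => by linarith [H j a b]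
  · exact key C B D hC hB hD h1 h3 (by linarith) fun j a b => by linarith [H j a b]
  · exact key C D B hC hD hB h2 h3 (by linarith) fun j a b => by linarith [H j a b]
  · exact key D C B hD hC hB h2 h1 (by linarith) fun j a b => by linarith [H j a b]
  · exact key D C B hD hC hB h2 h1 (by linarith) fun j a b => by linarith [H j a b]

/-- Integer version of the key lemma. -/
lemma core_int (r a b c d e s : ℤ) (hr : 13 < r) (hs : 0 < s) (hsr : 1000 * s < r)
    (he : Int.ModEq r (2 * a) e)
    (h1 : res r (a * s) + res r (b * s) + res r (c * s) + res r (d * s)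
      = res r (e * s) + s + 2 * r)
    (H : ∀ j : ℤ, 2 ≤ j → j < 22 →
      res r (a * (j * s)) + res r (b * (j * s)) + res r (c * (j * s)) + res r (d * (j * s))
      = res r (e * (j * s)) + j * s + r) : False := by
  have hr0 : 0 < r := by omega
  have hmul : ∀ x j : ℤ, res r (x * (j * s)) = j * res r (x * s) - r * (j * res r (x * s) / r) := by
    intro x j
    have : res r (x * (j * s)) = (j * res r (x * s)) % r := by
      unfold res
      rw [show x * (j * s) = j * (x * s) by ring]
      simp [Int.mul_emod]
    rw [this]
    have := Int.emod_add_mul_ediv (j * res r (x * s)) r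
    linarith
  have hnn : ∀ x, 0 ≤ res r x := fun x => Int.emod_nonneg _ (by omega)
  have hlt : ∀ x, res r x < r := fun x => Int.emod_lt_of_pos _ hr0
  have hE : res r (e * s) = (2 * res r (a * s)) % r := by
    unfold res
    have : Int.ModEq r (e * s) (2 * (a * s)) := by
      have := (he.symm).mul_right s
      rwa [mul_assoc] at this
    rw [this]
    simp [Int.mul_emod]
  simp only [hmul] at H
  set A := res r (a * s)
  set B := res r (b * s)
  set C := res r (c * s)
  set D := res r (d * s)
  set E := res r (e * s)
  have hA : 0 ≤ A := hnn (a * s)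
  have hB : 0 ≤ B := hnn (b * s)
  have hC : 0 ≤ C := hnn (c * s)
  have hD : 0 ≤ D := hnn (d * s)
  have hA' : A < r := hlt (a * s)
  have hB' : B < r := hlt (b * s)
  have hC' : C < r := hlt (c * s)
  have hD' : D < r := hlt (d * s)
  have H' : ∀ j : ℤ, 2 ≤ j → j < 22 →
      j * A / r + j * B / r + j * C / r + j * D / r = j * E / r + 2 * j - 1 := by
    intro j hj1 hj2
    have := H j hj1 hj2
    have h2 : r * (j * A / r + j * B / r + j * C / r + j * D / r)
      = r * (j * E / r + 2 * j - 1) := by linear_combination j * h1 - this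
    exact mul_left_cancel₀ (by omega) h2
  have hdd : ∀ j : ℤ, j * A / r = (2 * j * A / r) / 2 := by
    intro j
    rw [Int.ediv_ediv_of_nonneg (by omega), mul_comm r 2, mul_assoc,
      Int.mul_ediv_mul_of_pos _ _ (by norm_num)]
  obtain ⟨c', hc', hEc, hsum⟩ : ∃ c' : ℕ, ((c' = 1 ∧ r ≤ 2 * A) ∨ c' = 2) ∧
      E = 2 * A + (c' : ℤ) * r - 2 * r ∧ B + C + D = A + c' * r + s := by
    rcases lt_or_ge (2 * A) r with h | h
    · have : E = 2 * A := by rw [hE]; exact Int.emod_eq_of_lt (by omega) h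
      exact ⟨2, Or.inr rfl, by push_cast; linarith, by push_cast; linarith⟩
    · have : E = 2 * A - r := by
        rw [hE, ← Int.sub_emod_right]; exact Int.emod_eq_of_lt (by omega) (by omega)
      exact ⟨1, Or.inl ⟨rfl, h⟩, by push_cast; linarith, by push_cast; linarith⟩
  have hf : ∀ j : ℤ, j * E / r = 2 * j * A / r + j * c' - 2 * j := by
    intro j
    rw [hEc, show j * (2 * A + (c' : ℤ) * r - 2 * r) = 2 * j * A + r * (j * c' - 2 * j) by ring,
      Int.add_mul_ediv_left _ _ (by omega)]
    ring
  clear hmul hE h1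
  clear_value A B C D E
  lift A to ℕ using hA
  lift B to ℕ using hB
  lift C to ℕ using hC
  lift D to ℕ using hD
  lift r to ℕ using hr0.le
  lift s to ℕ using hs.le
  refine core c' r A B C D s (by exact_mod_cast hc') (by omega) (by omega) (by omega) (by omega)
    (by omega) (by omega) (by exact_mod_cast hsum) ?_
  intro j hj1 hj2
  have h2 := H' j (by omega) (by omega)
  rw [hdd, hf] at h2
  have h3 : (2 * (j : ℤ) * A / r) / 2 + j * B / r + j * C / r + j * D / r + 1
      = 2 * j * A / r + c' * j := by linear_combination h2
  exact_mod_cast h3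

/-- The value of `α_k(f)` is attained and is an integer over `r`. -/
lemma vf_attained (r a b c d e k : ℤ) (S : Set (Fin 4 → ℕ)) (hr : 0 < r)
    (hW : WeightCond r a b c d e S) (hS : FormSq S) :
    ∃ n : ℤ, 0 ≤ n ∧ n ≤ 2 * res r (a * k) ∧ Int.ModEq r n (e * k) ∧
      (0 < res r (a * k) → 0 < res r (b * k) → 0 < res r (c * k) → 0 < res r (d * k) → 0 < n) ∧
      vf S (alphaK r a b c d k) = (n : ℝ) / r := by
  have hnn : ∀ x, 0 ≤ res r x := fun x => Int.emod_nonneg _ (by omega)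
  have hmod : ∀ x, Int.ModEq r (res r x) x := fun x => Int.mod_modEq _ _
  let g : (Fin 4 → ℕ) → ℤ := fun m =>
    m 0 * res r (a * k) + m 1 * res r (b * k) + m 2 * res r (c * k) + m 3 * res r (d * k)
  have hg : ∀ m, 0 ≤ g m := fun m => by
    have := hnn (a * k); have := hnn (b * k); have := hnn (c * k); have := hnn (d * k)
    positivity
  have hrR : (0 : ℝ) < r := by exact_mod_cast hr
  have hval : ∀ m : Fin 4 → ℕ, ∑ i : Fin 4, (m i : ℝ) * ((alphaK r a b c d k i : ℚ) : ℝ)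
      = (g m : ℝ) / r := by
    intro m
    simp only [Fin.sum_univ_four, alphaK, g]
    simp
    ring
  obtain ⟨hx, hord⟩ := hS
  obtain ⟨m0, hm0, hmin⟩ : ∃ m0 ∈ S, ∀ m ∈ S, g m0 ≤ g m := by
    obtain ⟨m0, hm0, hmin⟩ := (measure (fun m => (g m).toNat)).wf.has_min S ⟨_, hx⟩
    refine ⟨m0, hm0, fun m hm => ?_⟩
    have := hmin m hm
    have h1 : ¬ (g m).toNat < (g m0).toNat := this
    have := hg m; have := hg m0
    omega
  refine ⟨g m0, hg m0, ?_, ?_, ?_, ?_⟩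
  · have := hmin _ hx
    simpa [g] using this
  · have h1 : Int.ModEq r (g m0)
        (m0 0 * (a * k) + m0 1 * (b * k) + m0 2 * (c * k) + m0 3 * (d * k)) :=
      ((((hmod _).mul_left _).add ((hmod _).mul_left _)).add ((hmod _).mul_left _)).add
        ((hmod _).mul_left _)
    have h2 := (hW m0 hm0).mul_right k
    refine h1.trans ?_
    convert h2 using 1
    ring
  · intro pa pb pc pd
    have := hord m0 hm0
    have h4 : 0 < m0 0 ∨ 0 < m0 1 ∨ 0 < m0 2 ∨ 0 < m0 3 := by omega
    simp only [g]
    rcases h4 with h | h | h | h <;> positivity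
  · unfold vf
    apply IsLeast.csInf_eq
    refine ⟨⟨m0, hm0, (hval m0).symm⟩, ?_⟩
    rintro x ⟨m, hm, rfl⟩
    rw [hval]
    have : (g m0 : ℝ) ≤ g m := by exact_mod_cast hmin m hm
    gcongr

lemma dvd_of_gcd {r a b k : ℤ} (h : Int.gcd a (Int.gcd b r) = 1) (ha : r ∣ a * k)
    (hb : r ∣ b * k) : r ∣ k := by
  have h1 : (r : ℤ) ∣ (Int.gcd b r : ℤ) * k := by
    rw [Int.gcd_eq_gcd_ab b r]
    have : (b * Int.gcdA b r + r * Int.gcdB b r) * k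
        = (b * k) * Int.gcdA b r + r * (Int.gcdB b r * k) := by ring
    rw [this]
    exact dvd_add (hb.mul_right _) (dvd_mul_right _ _)
  have h2 : (1 : ℤ) = a * Int.gcdA a (Int.gcd b r) + Int.gcd b r * Int.gcdB a (Int.gcd b r) := by
    rw [← Int.gcd_eq_gcd_ab, h]; rfl
  have : k = (a * k) * Int.gcdA a (Int.gcd b r)
      + (Int.gcd b r * k) * Int.gcdB a (Int.gcd b r) := by
    linear_combination k * h2
  rw [this]
  exact dvd_add (ha.mul_right _) (h1.mul_right _)

lemma dvd_e {r a e k : ℤ} (h : Int.gcd a r ∣ Int.gcd e r) (ha : r ∣ a * k) : r ∣ e * k := by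
  have h1 : (r : ℤ) ∣ (Int.gcd a r : ℤ) * k := by
    rw [Int.gcd_eq_gcd_ab a r]
    have : (a * Int.gcdA a r + r * Int.gcdB a r) * k
        = (a * k) * Int.gcdA a r + r * (Int.gcdB a r * k) := by ring
    rw [this]
    exact dvd_add (ha.mul_right _) (dvd_mul_right _ _)
  have h2 : (Int.gcd a r : ℤ) ∣ e := (Int.natCast_dvd_natCast.2 h).trans (Int.gcd_dvd_left ..)
  exact h1.trans (mul_dvd_mul_right h2 k)

lemma res_neg {r : ℤ} (hr : 0 < r) (x k : ℤ) :
    (res r (x * k) = 0 ∧ res r (x * (r - k)) = 0) ∨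
    (0 < res r (x * k) ∧ res r (x * (r - k)) = r - res r (x * k)) := by
  have h0 : 0 ≤ res r (x * k) := Int.emod_nonneg _ (by omega)
  have h1 : res r (x * k) < r := Int.emod_lt_of_pos _ hr
  have h2 : res r (x * (r - k)) = (- res r (x * k)) % r := by
    unfold res
    rw [show x * (r - k) = -(x * k) + r * x by ring, Int.add_mul_emod_self_left]
    have : Int.ModEq r (-(x * k)) (-(x * k % r)) := (Int.mod_modEq _ _).symm.neg
    exact this
  rcases h0.eq_or_lt with h | h
  · left
    refine ⟨h.symm, ?_⟩
    rw [h2, ← h]; simp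
  · right
    refine ⟨h, ?_⟩
    rw [h2, ← Int.add_emod_right]
    rw [Int.emod_eq_of_lt (by omega) (by omega)]
    ring

/-- What Rules I and II say about `α_k`, in integer form. -/
lemma info (r : ℤ) (δ : ℝ) (a b c d e : ℤ) (S : Set (Fin 4 → ℕ)) (B : Set (Fin 4 → ℚ))
    (hr : 13 < r) (hδ : δ ≤ 1 / 1000) (hW : WeightCond r a b c d e S)
    (hI : RuleI r a b c d δ S B) (hII : RuleII r a b c d e) (hS : FormSq S)
    (k : ℤ) (hk1 : 1 ≤ k) (hk2 : k ≤ r - 1) :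
    ∃ n : ℤ, (n = res r (e * k) ∨ res r (e * k) + r ≤ n) ∧
      (0 < res r (a * k) → 0 < res r (b * k) → 0 < res r (c * k) → 0 < res r (d * k) → 0 < n) ∧
      ((alphaK r a b c d k ∉ B ∧
          n + k + r ≤ res r (a * k) + res r (b * k) + res r (c * k) + res r (d * k)) ∨
        (alphaK r a b c d k ∈ B ∧ 1000 * (r - k) < r ∧
          res r (a * k) + res r (b * k) + res r (c * k) + res r (d * k) = n + k)) := by
  have hr0 : 0 < r := by omega
  have hrR : (0 : ℝ) < r := by exact_mod_cast hr0
  have hrQ : (0 : ℚ) < r := by exact_mod_cast hr0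
  obtain ⟨n, hn0, -, hne, hpos, hvf⟩ := vf_attained r a b c d e k S hr0 hW hS
  obtain ⟨-, -, -, -, gab, -, -, -, -, -, hsum⟩ := hII
  obtain ⟨-, -, hB, hout⟩ := hI
  have hnn : ∀ x, 0 ≤ res r x := fun x => Int.emod_nonneg _ (by omega)
  have hlt : ∀ x, res r x < r := fun x => Int.emod_lt_of_pos _ hr0
  have hmod : ∀ x, Int.ModEq r (res r x) x := fun x => Int.mod_modEq _ _
  have hwr : ((w (alphaK r a b c d k) : ℚ) : ℝ) - vf S (alphaK r a b c d k)
      = ((res r (a * k) + res r (b * k) + res r (c * k) + res r (d * k) - n : ℤ) : ℝ) / r := by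
    rw [hvf]
    simp only [w, Fin.sum_univ_four, alphaK]
    simp
    ring
  have hmem : alphaK r a b c d k ∈ latN r a b c d ∩ orth := by
    constructor
    · refine ⟨k, fun i => - (![a, b, c, d] i * k / r), fun i => ?_⟩
      have h := Int.emod_add_mul_ediv (![a, b, c, d] i * k) r
      simp only [alphaK, res]
      have h' : ((![a, b, c, d] i * k % r : ℤ) : ℚ)
          = ((k * ![a, b, c, d] i : ℤ) : ℚ) - r * ((![a, b, c, d] i * k / r : ℤ) : ℚ) := by
        rw [eq_sub_iff_add_eq, mul_comm k]; exact_mod_cast h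
      rw [h', Int.cast_neg]
      field_simp
      ring
    · intro i
      exact div_nonneg (by exact_mod_cast hnn _) hrQ.le
  have hnc : alphaK r a b c d k ∉ corners := by
    rintro (h | ⟨i, h⟩)
    · have h0 := congrFun h 0
      have h1 := congrFun h 1
      simp [alphaK, hrQ.ne'] at h0 h1
      have hh : r ∣ k := dvd_of_gcd gab (Int.dvd_of_emod_eq_zero h0) (Int.dvd_of_emod_eq_zero h1)
      have := Int.le_of_dvd (by omega) hh
      omega
    · have h0 := congrFun h i
      simp only [alphaK, if_true] at h0
      rw [div_eq_one_iff_eq hrQ.ne'] at h0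
      have h0' : res r (![a, b, c, d] i * k) = r := by exact_mod_cast h0
      have := hlt (![a, b, c, d] i * k)
      omega
  have hn : n = res r (e * k) ∨ res r (e * k) + r ≤ n := by
    have h1 : res r (e * k) = n % r := hne.symm
    have h2 := Int.emod_add_mul_ediv n r
    have h3 : 0 ≤ n / r := Int.ediv_nonneg hn0 hr0.le
    rcases h3.eq_or_lt with h | h
    · left; rw [h1]; rw [← h] at h2; linarith
    · right; rw [h1]; nlinarith
  set T := res r (a * k) + res r (b * k) + res r (c * k) + res r (d * k) with hT
  obtain ⟨q, hq⟩ : r ∣ (T - n) - k := by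
    have h1 : Int.ModEq r (T - n) (a * k + b * k + c * k + d * k - e * k) :=
      ((((hmod _).add (hmod _)).add (hmod _)).add (hmod _)).sub hne
    have h2 := hsum.mul_right k
    have h3 : Int.ModEq r (T - n) k := by
      refine h1.trans ?_
      convert h2 using 1 <;> ring
    exact h3.symm.dvd
  refine ⟨n, hn, hpos, ?_⟩
  by_cases hb : alphaK r a b c d k ∈ B
  · right
    obtain ⟨-, h1, h2⟩ := hB _ hb
    rw [hwr] at h1 h2
    rw [lt_div_iff₀ hrR] at h1
    rw [div_lt_one hrR] at h2
    have h2' : T - n < r := by exact_mod_cast h2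
    have h4 : 999 * (r : ℝ) < 1000 * ((T - n : ℤ) : ℝ) := by nlinarith
    have h4' : 999 * r < 1000 * (T - n) := by exact_mod_cast h4
    have hq0 : q = 0 := by
      have : q < 1 := by nlinarith
      have : -1 < q := by nlinarith
      omega
    rw [hq0] at hq
    refine ⟨hb, by omega, by omega⟩
  · left
    refine ⟨hb, ?_⟩
    have h1 := hout _ hmem hb hnc
    rw [hwr, lt_div_iff₀ hrR, one_mul] at h1
    have h1' : r < T - n := by exact_mod_cast h1
    have : 0 < q := by nlinarith
    nlinarith

lemma zeros (r a b c d e : ℤ) (hr : 13 < r) (hII : RuleII r a b c d e)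
    (k : ℤ) (hk1 : 1 ≤ k) (hk2 : k ≤ r - 1) :
    (0 < res r (a * k) ∧ 0 < res r (b * k) ∧ 0 < res r (c * k) ∧ 0 < res r (d * k)) ∨
    (res r (e * k) = 0 ∧
      ((res r (a * k) = 0 ∧ 0 < res r (b * k) ∧ 0 < res r (c * k) ∧ 0 < res r (d * k)) ∨
       (0 < res r (a * k) ∧ res r (b * k) = 0 ∧ 0 < res r (c * k) ∧ 0 < res r (d * k)) ∨
       (0 < res r (a * k) ∧ 0 < res r (b * k) ∧ res r (c * k) = 0 ∧ 0 < res r (d * k)) ∨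
       (0 < res r (a * k) ∧ 0 < res r (b * k) ∧ 0 < res r (c * k) ∧ res r (d * k) = 0))) := by
  obtain ⟨ga, gb, gc, gd, gab, gac, gad, gbc, gbd, gcd, -⟩ := hII
  have hnn : ∀ x, 0 ≤ res r x := fun x => Int.emod_nonneg _ (by omega)
  have hz : ∀ x, res r (x * k) = 0 → r ∣ x * k := fun x h => Int.dvd_of_emod_eq_zero h
  have hE : ∀ x, Int.gcd x r ∣ Int.gcd e r → res r (x * k) ≠ 0 ∨ res r (e * k) = 0 :=
    fun x hx => or_iff_not_imp_left.2 fun h' =>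
      have h := not_not.1 h'
      Int.emod_eq_zero_of_dvd (dvd_e hx (hz x h))
  have hP : ∀ x y, Int.gcd x (Int.gcd y r) = 1 →
      ¬ (res r (x * k) = 0 ∧ res r (y * k) = 0) := by
    rintro x y h ⟨h1, h2⟩
    have := Int.le_of_dvd (by omega) (dvd_of_gcd h (hz x h1) (hz y h2))
    omega
  have h1 := hE a ga
  have h2 := hE b gb
  have h3 := hE c gc
  have h4 := hE d gd
  have p1 := hP a b gab
  have p2 := hP a c gac
  have p3 := hP a d gad
  have p4 := hP b c gbc
  have p5 := hP b d gbd
  have p6 := hP c d gcd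
  have := hnn (a * k)
  have := hnn (b * k)
  have := hnn (c * k)
  have := hnn (d * k)
  generalize res r (a * k) = A at *
  generalize res r (b * k) = B at *
  generalize res r (c * k) = C at *
  generalize res r (d * k) = D at *
  generalize res r (e * k) = E at *
  clear ga gb gc gd gab gac gad gbc gbd gcd hz hE hP hnn
  omega

lemma alphaK_inj (r a b c d e : ℤ) (hr : 13 < r) (hII : RuleII r a b c d e)
    (j k : ℤ) (hj1 : 1 ≤ j) (hj2 : j ≤ r - 1) (hk1 : 1 ≤ k) (hk2 : k ≤ r - 1)
    (h : alphaK r a b c d j = alphaK r a b c d k) : j = k := by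
  obtain ⟨-, -, -, -, gab, -⟩ := hII
  have hrQ : (r : ℚ) ≠ 0 := by
    have : r ≠ 0 := by omega
    exact_mod_cast this
  have key : ∀ i, r ∣ ![a, b, c, d] i * (j - k) := by
    intro i
    have h0 := congrFun h i
    simp only [alphaK] at h0
    rw [div_left_inj' hrQ] at h0
    have h1 : (![a, b, c, d] i * j) % r = (![a, b, c, d] i * k) % r := by exact_mod_cast h0
    have := Int.ModEq.dvd (Eq.symm h1 : Int.ModEq r _ _)
    rwa [← mul_sub] at this
  have h1 : r ∣ j - k := dvd_of_gcd gab (key 0) (key 1)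
  have := Int.eq_zero_of_abs_lt_dvd h1 (by rw [abs_lt]; omega)
  omega

/-- Proposition (x²), part (4), in the square case. -/
theorem statement14 :
    ∃ δstar : ℝ, 0 < δstar ∧ δstar ≤ 1 / 13 ∧
      ∀ (r : ℤ) (δ : ℝ) (a b c d e : ℤ) (S : Set (Fin 4 → ℕ)) (B : Set (Fin 4 → ℚ)),
        13 < r → 0 < δ → δ ≤ δstar →
        WeightCond r a b c d e S → RuleI r a b c d δ S B → RuleII r a b c d e →
        FormSq S →
        ∀ k : ℤ, 1 ≤ k → k ≤ r - 1 →
          res r (a * k) + res r (b * k) + res r (c * k) + res r (d * k)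
            = res r (e * k) + k + r := by
  refine ⟨1 / 1000, by norm_num, by norm_num, ?_⟩
  intro r δ a b c d e S B hr hδ0 hδ hW hI hII hS
  have hr0 : 0 < r := by omega
  have hinfo := info r δ a b c d e S B hr hδ hW hI hII hS
  have hzero := zeros r a b c d e hr hII
  have he : Int.ModEq r (2 * a) e := by
    have := hW _ hS.1
    simpa using this
  -- the generic case
  have hgen : ∀ k : ℤ, 1 ≤ k → k ≤ r - 1 → alphaK r a b c d k ∉ B →
      alphaK r a b c d (r - k) ∉ B →
      res r (a * k) + res r (b * k) + res r (c * k) + res r (d * k) = res r (e * k) + k + r := by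
    intro k hk1 hk2 hb1 hb2
    obtain ⟨n, hn, hp, h⟩ := hinfo k hk1 hk2
    obtain ⟨n', hn', hp', h'⟩ := hinfo (r - k) (by omega) (by omega)
    replace h := h.resolve_right (fun h => hb1 h.1)
    replace h' := h'.resolve_right (fun h => hb2 h.1)
    obtain ⟨-, h⟩ := h
    obtain ⟨-, h'⟩ := h'
    have ra := res_neg hr0 a k
    have rb := res_neg hr0 b k
    have rc := res_neg hr0 c k
    have rd := res_neg hr0 d k
    have re := res_neg hr0 e k
    have la : res r (a * k) < r := Int.emod_lt_of_pos _ hr0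
    have lb : res r (b * k) < r := Int.emod_lt_of_pos _ hr0
    have lc : res r (c * k) < r := Int.emod_lt_of_pos _ hr0
    have ld : res r (d * k) < r := Int.emod_lt_of_pos _ hr0
    rcases hzero k hk1 hk2 with ⟨pa, pb, pc, pd⟩ | ⟨hE, hz⟩
    · have := hp pa pb pc pd
      have := hp' (by omega) (by omega) (by omega) (by omega)
      omega
    · omega
  -- the exceptional vector
  have hexc : ∀ k : ℤ, 1 ≤ k → k ≤ r - 1 → alphaK r a b c d k ∈ B →
      (res r (a * k) + res r (b * k) + res r (c * k) + res r (d * k) = res r (e * k) + k + r ∧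
       res r (a * (r - k)) + res r (b * (r - k)) + res r (c * (r - k)) + res r (d * (r - k))
        = res r (e * (r - k)) + (r - k) + r) := by
    intro k hk1 hk2 hb1
    obtain ⟨n, hn, hp, h⟩ := hinfo k hk1 hk2
    obtain ⟨n', hn', hp', h'⟩ := hinfo (r - k) (by omega) (by omega)
    replace h := h.resolve_left (fun h => h.1 hb1)
    obtain ⟨-, hks, h⟩ := h
    replace h' := h'.resolve_right (fun h => by omega)
    obtain ⟨hb2, h'⟩ := h'
    have hbad : ¬ (res r (a * (r - k)) + res r (b * (r - k)) + res r (c * (r - k))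
        + res r (d * (r - k)) = res r (e * (r - k)) + (r - k) + 2 * r) := by
      intro hbad
      refine core_int r a b c d e (r - k) hr (by omega) (by omega) he hbad ?_
      intro j hj1 hj2
      have l1 : 2 * (r - k) ≤ j * (r - k) := by nlinarith
      have l2 : j * (r - k) ≤ 22 * (r - k) := by nlinarith
      have hne : ∀ i : ℤ, 1 ≤ i → i ≤ r - 1 → i ≠ k → alphaK r a b c d i ∉ B :=
        fun i hi1 hi2 hik hi =>
          hik (alphaK_inj r a b c d e hr hII i k hi1 hi2 hk1 hk2 (hI.1 hi hb1))
      refine hgen _ (by omega) (by omega) (hne _ (by omega) (by omega) (by omega))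
        (hne _ (by omega) (by omega) (by omega))
    have ra := res_neg hr0 a k
    have rb := res_neg hr0 b k
    have rc := res_neg hr0 c k
    have rd := res_neg hr0 d k
    have re := res_neg hr0 e k
    have la : res r (a * k) < r := Int.emod_lt_of_pos _ hr0
    have lb : res r (b * k) < r := Int.emod_lt_of_pos _ hr0
    have lc : res r (c * k) < r := Int.emod_lt_of_pos _ hr0
    have ld : res r (d * k) < r := Int.emod_lt_of_pos _ hr0
    rcases hzero k hk1 hk2 with ⟨pa, pb, pc, pd⟩ | ⟨hE, hz⟩
    · have := hp pa pb pc pd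
      have := hp' (by omega) (by omega) (by omega) (by omega)
      omega
    · omega
  intro k hk1 hk2
  by_cases hb1 : alphaK r a b c d k ∈ B
  · exact (hexc k hk1 hk2 hb1).1
  · by_cases hb2 : alphaK r a b c d (r - k) ∈ B
    · have := (hexc (r - k) (by omega) (by omega) hb2).2
      simpa using this
    · exact hgen k hk1 hk2 hb1 hb2

end GapPaper
end

section
/- There exists a real constant $\delta^*$ with $0<\delta^*\leq 1/13$ such that, in the hyperquotient setup with $\delta\leq\delta^*$, with the cA form and Rules I and II, necessarily $a+b\equiv 0 \pmod r$, $e\equiv 0 \pmod r$, and either ($c\equiv 1$ and $d\equiv 0 \pmod r$) or ($c\equiv 0$ and $d\equiv 1 \pmod r$); that is, up to interchanging $z$ and $t$, the type is $\frac{1}{r}(a,-a,1,0;0)$. -/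
open scoped BigOperators

namespace GapPaper

def Cfg (r s e a b j0 : ℤ) : Prop :=
  ∀ j D E : ℤ, 1 ≤ j → j < r → j ≠ j0 → 0 ≤ D → D + j ≤ r → r ∣ D - j * s →
    0 ≤ E → E < r → r ∣ E - j * e →
    (∃ P U : ℤ, 0 ≤ P ∧ 0 ≤ U ∧ 2 ≤ P + U ∧ P * (r - j - D) + U * D = E ∧
      r ∣ P * (1 + s) - U * s + e) ∧ (a * j) % r + (b * j) % r = E + r

theorem Cfg.congr_e {r s e e' a b j0 : ℤ} (h : Cfg r s e a b j0) (he : r ∣ e - e') :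
    Cfg r s e' a b j0 := by
  intro j D E h1 h2 h3 h4 h5 h6 h7 h8 h9
  have := h j D E h1 h2 h3 h4 h5 h6 h7 h8 (by
    have : E - j * e = (E - j * e') - j * (e - e') := by ring
    rw [this]; exact dvd_sub h9 (Dvd.dvd.mul_left he _))
  obtain ⟨⟨P, U, a1, a2, a3, a4, a5⟩, h10⟩ := this
  refine ⟨⟨P, U, a1, a2, a3, a4, ?_⟩, h10⟩
  have : P * (1 + s) - U * s + e' = (P * (1 + s) - U * s + e) - (e - e') := by ring
  rw [this]; exact dvd_sub a5 he

theorem Cfg.swap {r s e a b j0 : ℤ} (h : Cfg r s e a b j0) :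
    Cfg r (r - 1 - s) e a b j0 := by
  intro j D E h1 h2 h3 h4 h5 h6 h7 h8 h9
  have := h j (r - j - D) E h1 h2 h3 (by linarith) (by linarith) (by
    have : r - j - D - j * s = r * (1 - j) - (D - j * (r - 1 - s)) := by ring
    rw [this]; exact dvd_sub (Dvd.intro _ rfl) h6) h7 h8 h9
  obtain ⟨⟨P, U, a1, a2, a3, a4, a5⟩, h10⟩ := this
  refine ⟨⟨U, P, a2, a1, by linarith, by rw [← a4]; ring, ?_⟩, h10⟩
  have : U * (1 + (r - 1 - s)) - P * (r - 1 - s) + e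
    = (P * (1 + s) - U * s + e) + r * (U - P) := by ring
  rw [this]; exact dvd_add a5 (Dvd.intro _ rfl)

/-- main usage form -/
theorem Cfg.ex {r s e a b j0 : ℤ} (h : Cfg r s e a b j0) (j D C E k i : ℤ)
    (h1 : 1 ≤ j) (h2 : j < r) (h3 : j ≠ j0) (hD : D = j * s - k * r) (hD0 : 0 ≤ D)
    (hC : C = r - j - D) (hC0 : 0 ≤ C) (hE : E = j * e - i * r) (hE0 : 0 ≤ E) (hE1 : E < r) :
    ∃ P U : ℤ, 0 ≤ P ∧ 0 ≤ U ∧ 2 ≤ P + U ∧ P * C + U * D = E ∧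
      r ∣ P * (1 + s) - U * s + e := by
  have := (h j D E h1 h2 h3 hD0 (by linarith) ⟨-k, by rw [hD]; ring⟩ hE0 hE1
    ⟨-i, by rw [hE]; ring⟩).1
  rw [hC]; exact this

theorem Cfg.carry {r s e a b j0 : ℤ} (h : Cfg r s e a b j0) (j D E k i : ℤ)
    (h1 : 1 ≤ j) (h2 : j < r) (h3 : j ≠ j0) (hD : D = j * s - k * r) (hD0 : 0 ≤ D)
    (hC : D + j ≤ r) (hE : E = j * e - i * r) (hE0 : 0 ≤ E) (hE1 : E < r) :
    (a * j) % r + (b * j) % r = E + r :=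
  (h j D E h1 h2 h3 hD0 (by linarith) ⟨-k, by rw [hD]; ring⟩ hE0 hE1
    ⟨-i, by rw [hE]; ring⟩).2

theorem pu_false {P U C D E : ℤ} (hP : 0 ≤ P) (hU : 0 ≤ U) (h : 2 ≤ P + U)
    (hE : P * C + U * D = E) (hC : 0 ≤ C) (hD : 0 ≤ D) (h1 : E < 2 * C) (h2 : E < 2 * D) :
    False := by
  rcases le_total C D with h' | h'
  · nlinarith [mul_nonneg hU (sub_nonneg.2 h')]
  · nlinarith [mul_nonneg hP (sub_nonneg.2 h')]

theorem pu_U0 {P U C D E : ℤ} (hP : 0 ≤ P) (hU : 0 ≤ U) (h : 2 ≤ P + U)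
    (hE : P * C + U * D = E) (hC : 0 ≤ C) (hD : 0 ≤ D) (h1 : E < C + D) (h2 : E < 2 * D) :
    U = 0 := by
  by_contra hne
  have hU1 : 1 ≤ U := by omega
  rcases le_or_gt (α := ℤ) 2 U with h3 | h3
  · nlinarith [mul_nonneg hP hC]
  · have : U = 1 := by omega
    subst this
    nlinarith

theorem pu_P0 {P U C D E : ℤ} (hP : 0 ≤ P) (hU : 0 ≤ U) (h : 2 ≤ P + U)
    (hE : P * C + U * D = E) (hC : 0 ≤ C) (hD : 0 ≤ D) (h1 : E < C + D) (h2 : E < 2 * C) :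
    P = 0 :=
  pu_U0 hU hP (by linarith) (by linarith) hD hC (by linarith) h2

/-- contradiction form -/
theorem Cfg.no {r s e a b j0 : ℤ} (h : Cfg r s e a b j0) (j D C E k i : ℤ)
    (h1 : 1 ≤ j) (h2 : j < r) (h3 : j ≠ j0) (hD : D = j * s - k * r) (hD0 : 0 ≤ D)
    (hC : C = r - j - D) (hC0 : 0 ≤ C) (hE : E = j * e - i * r) (hE0 : 0 ≤ E) (hE1 : E < r)
    (h5 : E < 2 * C) (h6 : E < 2 * D) : False := by
  obtain ⟨P, U, hP, hU, hs, he, -⟩ := h.ex j D C E k i h1 h2 h3 hD hD0 hC hC0 hE hE0 hE1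
  exact pu_false hP hU hs he hC0 hD0 h5 h6

/-- W-fact for e = 2s -/
theorem Cfg.W {r s a b j0 : ℤ} (h : Cfg r s (2 * s) a b j0) (j D C k : ℤ)
    (h1 : 1 ≤ j) (h2 : j < r) (h3 : j ≠ j0) (hD : D = j * s - k * r)
    (hC : C = r - j - D) (hC0 : 0 ≤ C) (hD1 : r ≤ 2 * D) :
    ∃ P : ℤ, 2 ≤ P ∧ (P + 2) * C = r - 2 * j := by
  obtain ⟨P, U, hP, hU, hs, he, -⟩ := h.ex j D C (2 * D - r) k (2 * k + 1) h1 h2 h3 hD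
    (by linarith) hC hC0 (by rw [hD]; ring) (by linarith) (by linarith)
  have hU0 : U = 0 := pu_U0 hP hU hs he hC0 (by linarith) (by linarith) (by linarith)
  subst hU0
  exact ⟨P, by linarith, by linarith⟩

theorem Cfg.W4 {r s a b j0 : ℤ} (h : Cfg r s (2 * s) a b j0) (j k : ℤ)
    (h1 : 1 ≤ j) (h2 : j < r) :
    j = j0 ∨ r < j * s - k * r + j ∨ 2 * (j * s - k * r) < r ∨
      4 * (r - j - (j * s - k * r)) = r - 2 * j ∨ 5 * (r - j - (j * s - k * r)) ≤ r - 2 * j := by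
  by_contra hh
  push Not at hh
  obtain ⟨q1, q2, q3, q4, q5⟩ := hh
  obtain ⟨P, hP, he⟩ := h.W j (j * s - k * r) (r - j - (j * s - k * r)) k h1 h2 q1 rfl rfl
    (by linarith) q3
  generalize r - j - (j * s - k * r) = C at *
  rcases eq_or_lt_of_le hP with h5 | h5
  · subst h5; apply q4; linarith
  · have : 3 ≤ P := h5
    have hC : 0 ≤ C := by
      by_contra hc
      nlinarith
    nlinarith

theorem Cfg.base {r s e a b j0 : ℤ} (h : Cfg r s e a b j0) (hr : 13 < r) (hs : 1 ≤ s)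
    (hs2 : 2 * s ≤ r - 1) (hj : 1 ≠ j0) :
    ∃ q : ℤ, 2 ≤ q ∧ q * s ≤ r - 2 ∧ r ∣ e - q * s := by
  have hr0 : (0:ℤ) < r := by linarith
  have hE0 := Int.emod_nonneg e hr0.ne'
  have hE1 := Int.emod_lt_of_pos e hr0
  have hdm := Int.emod_add_mul_ediv e r
  have hc := h.carry 1 s (e % r) 0 (e / r) le_rfl (by linarith) hj (by ring) (by linarith)
    (by linarith) (by linarith) hE0 hE1
  obtain ⟨P, U, hP, hU, hPU, he, -⟩ := h.ex 1 s (r - 1 - s) (e % r) 0 (e / r) le_rfl (by linarith)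
    hj (by ring) (by linarith) (by ring) (by linarith) (by linarith) hE0 hE1
  have hA := Int.emod_lt_of_pos (a * 1) hr0
  have hB := Int.emod_lt_of_pos (b * 1) hr0
  have hP0 : P = 0 := pu_P0 hP hU hPU he (by linarith) (by linarith) (by linarith) (by linarith)
  subst hP0
  refine ⟨U, by linarith, by linarith, ⟨e / r, by linarith⟩⟩

theorem Cfg.G {r s q a b j0 : ℤ} (h : Cfg r s (q * s) a b j0) (j i : ℤ) (hr : 13 < r)
    (hs : 1 ≤ s) (hj1 : 1 ≤ j) (hj : j ≠ j0) (hjr : j * (s + 1) ≤ r)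
    (hi1 : i * r ≤ j * (q * s)) (hi2 : j * (q * s) < (i + 1) * r) :
    ∃ l P U : ℤ, 0 ≤ P ∧ 0 ≤ U ∧ 2 ≤ P + U ∧ P = j * l - i ∧
      l * (r - j * (s + 1)) = (q - U - i) * s - i := by
  have hjs : 1 ≤ j * s := by nlinarith
  obtain ⟨P, U, hP, hU, hPU, he, l, hl⟩ := h.ex j (j * s) (r - j * (s + 1)) (j * (q * s) - i * r) 0 i
    hj1 (by nlinarith) hj (by ring) (by linarith) (by ring) (by linarith) rfl (by linarith)
    (by linarith)
  have h1 : P = j * l - i := by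
    have : r * P = r * (j * l - i) := by linear_combination he + j * hl
    exact mul_left_cancel₀ (by linarith) this
  refine ⟨l, P, U, hP, hU, hPU, h1, ?_⟩
  subst h1
  linear_combination -hl

theorem Cfg.G1 {r s q a b j0 : ℤ} (h : Cfg r s (q * s) a b j0) (n : ℤ) (hr : 13 < r)
    (hs : 1 ≤ s) (hq : 2 ≤ q) (hqs : q * s ≤ r - 2) (hn : 1 ≤ n) (hn1 : n * (q * s) ≤ r - 1)
    (hn2 : r ≤ (n + 1) * (q * s)) (hj : n + 1 ≠ j0) :
    q = 2 ∧ (s = 1 ∨ r = 4 * s + 2 ∨ ∃ l h : ℤ, 2 ≤ l ∧ 1 ≤ h ∧ r = 2 * s + 2 + h ∧ l * h = s - 1) := by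
  by_cases h21 : q = 2 ∧ s = 1
  · exact ⟨h21.1, Or.inl h21.2⟩
  have hqs2 : 2 * s ≤ q * s := by nlinarith
  have hjr : (n + 1) * (s + 1) ≤ r := by
    by_cases hs1 : s = 1
    · subst hs1
      have : 3 ≤ q := by omega
      nlinarith
    · have hs2 : 2 ≤ s := by omega
      rcases eq_or_lt_of_le hn with h1 | h1
      · subst h1; linarith
      · have : 2 ≤ n := h1
        nlinarith
  obtain ⟨l, P, U, hP, hU, hPU, hPl, hl⟩ := h.G (n + 1) 1 hr hs (by linarith) hj hjr (by linarith)
    (by linarith)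
  have hl1 : 1 ≤ l := by
    by_contra hc
    have : l ≤ 0 := by omega
    nlinarith
  have hC : 0 ≤ r - (n + 1) * (s + 1) := by linarith
  have hUs : 0 ≤ U * s := by positivity
  have hb : r ≤ q * s + n * s + n := by nlinarith
  rcases le_or_gt (α := ℤ) 4 n with h4 | h4
  · exfalso
    by_cases hs1 : s = 1
    · subst hs1
      have : 3 ≤ q := by omega
      nlinarith
    · have hs2 : 2 ≤ s := by omega
      have e1 : 4 * (q * s) ≤ n * (q * s) := by nlinarith
      have e2 : n * (2 * s) ≤ n * (q * s) := by nlinarith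
      have e3 : n * 4 ≤ n * (q * s) := by nlinarith
      nlinarith
  · obtain rfl | rfl | rfl : n = 1 ∨ n = 2 ∨ n = 3 := by omega
    · rcases eq_or_lt_of_le hl1 with h1 | h1
      · exfalso
        subst h1
        nlinarith
      · have hl2 : 2 ≤ l := h1
        have h3 : r ≤ 3 * s + 1 := by nlinarith
        have hq2 : q = 2 := by
          by_contra hc
          have : 3 ≤ q := by omega
          nlinarith
        subst hq2
        have hU0 : U = 0 := by
          by_contra hc
          have : 1 ≤ U := by omega
          nlinarith
        subst hU0
        refine ⟨rfl, Or.inr (Or.inr ⟨l, r - 2 * s - 2, hl2, ?_, by ring, by linarith⟩)⟩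
        by_contra hc
        have : r = 2 * s + 2 := by linarith
        subst this
        have : s = 1 := by linarith
        omega
    · have hq2 : q = 2 := by
        by_contra hc
        have : 3 ≤ q := by omega
        nlinarith
      subst hq2
      have hU0 : U = 0 := by
        by_contra hc
        have : 1 ≤ U := by omega
        nlinarith
      subst hU0
      refine ⟨rfl, Or.inr (Or.inl ?_)⟩
      by_contra hc
      have h41 : r = 4 * s + 1 := by omega
      subst h41
      rcases eq_or_lt_of_le hl1 with h1 | h1
      · subst h1; linarith
      · have hl2 : 2 ≤ l := h1
        nlinarith
    · exfalso
      linarith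

theorem exists_n (r x : ℤ) (hx : 1 ≤ x) (hxr : x ≤ r - 1) :
    ∃ n : ℤ, 1 ≤ n ∧ n * x ≤ r - 1 ∧ r ≤ (n + 1) * x := by
  refine ⟨(r - 1) / x, ?_, Int.ediv_mul_le _ (by linarith), ?_⟩
  · rw [Int.le_ediv_iff_mul_le (by linarith)]; linarith
  · have := Int.lt_ediv_add_one_mul_self (r - 1) (show 0 < x by linarith)
    linarith


theorem emod_of {x y r : ℤ} (k : ℤ) (h : x = y + r * k) (h0 : 0 ≤ y) (h1 : y < r) : x % r = y := by
  rw [h, Int.add_mul_emod_self_left, Int.emod_eq_of_lt h0 h1]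

theorem ex_of_emod {x r : ℤ} (hr : 0 < r) :
    ∃ k : ℤ, x = x % r + r * k ∧ 0 ≤ x % r ∧ x % r ≤ r - 1 :=
  ⟨x / r, (Int.emod_add_mul_ediv x r).symm, Int.emod_nonneg _ hr.ne',
    by have := Int.emod_lt_of_pos x hr; omega⟩

theorem kill_s1 {r a b j0 : ℤ} (h : Cfg r 1 2 a b j0) (hr : 13 < r)
    (hj : j0 = 0 ∨ (1 ≤ j0 ∧ 100000 * j0 ≤ r)) : False := by
  have hr0 : (0:ℤ) < r := by linarith
  rcases Int.even_or_odd' r with ⟨m, hm | hm⟩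
  · have hc := h.carry (m - 1) (m - 1) (r - 2) 0 0 (by omega) (by omega) (by omega) (by ring)
      (by omega) (by omega) (by rw [hm]; ring) (by omega) (by omega)
    obtain ⟨k, hk, h0, h1⟩ := ex_of_emod (x := a * (m - 1)) hr0
    obtain ⟨k', hk', h0', h1'⟩ := ex_of_emod (x := b * (m - 1)) hr0
    have hA : (a * (m - 1)) % r = r - 1 := by omega
    have hB : (b * (m - 1)) % r = r - 1 := by omega
    rw [hA] at hk
    rw [hB] at hk'
    by_cases hj2 : j0 = 2
    · have hc2 := h.carry 4 4 8 0 0 (by omega) (by omega) (by omega) (by ring)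
        (by omega) (by omega) (by ring) (by omega) (by omega)
      rw [emod_of (y := 4) (2 * (a - 2 - 2 * k)) (by linear_combination -4 * hk - 2 * a * hm)
        (by omega) (by omega),
        emod_of (y := 4) (2 * (b - 2 - 2 * k')) (by linear_combination -4 * hk' - 2 * b * hm)
        (by omega) (by omega)] at hc2
      omega
    · have hc2 := h.carry 2 2 4 0 0 (by omega) (by omega) (by omega) (by ring)
        (by omega) (by omega) (by ring) (by omega) (by omega)
      rw [emod_of (y := 2) (a - 2 - 2 * k) (by linear_combination -2 * hk - a * hm)
        (by omega) (by omega),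
        emod_of (y := 2) (b - 2 - 2 * k') (by linear_combination -2 * hk' - b * hm)
        (by omega) (by omega)] at hc2
      omega
  · have hc := h.carry m m (2 * m) 0 0 (by omega) (by omega) (by omega) (by ring)
      (by omega) (by omega) (by ring) (by omega) (by omega)
    have := Int.emod_lt_of_pos (a * m) hr0
    have := Int.emod_lt_of_pos (b * m) hr0
    omega

theorem kill_42 {r s a b j0 : ℤ} (h : Cfg r s (2 * s) a b j0) (hr : 13 < r)
    (hj : j0 = 0 ∨ (1 ≤ j0 ∧ 100000 * j0 ≤ r)) (hrs : r = 4 * s + 2) : False := by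
  have hr0 : (0:ℤ) < r := by linarith
  have par : ∀ x : ℤ, (2 * x) % r % 2 = 0 := by
    intro x
    rw [Int.emod_emod_of_dvd _ ⟨2 * s + 1, by linarith⟩]; omega
  by_cases hj2 : j0 = 2
  · have c6 := h.carry 6 (2 * s - 2) (r - 6) 1 2 (by omega) (by omega) (by omega) (by omega)
        (by omega) (by omega) (by omega) (by omega) (by omega)
    have c10 := h.carry 10 (2 * s - 4) (r - 10) 2 4 (by omega) (by omega) (by omega) (by omega)
        (by omega) (by omega) (by omega) (by omega) (by omega)
    have p1 := par (a * 3)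
    have p2 := par (b * 3)
    have p3 := par (a * 5)
    have p4 := par (b * 5)
    rw [show 2 * (a * 3) = a * 6 by ring] at p1
    rw [show 2 * (b * 3) = b * 6 by ring] at p2
    rw [show 2 * (a * 5) = a * 10 by ring] at p3
    rw [show 2 * (b * 5) = b * 10 by ring] at p4
    obtain ⟨k, hk, h0, h1⟩ := ex_of_emod (x := a * 6) hr0
    obtain ⟨k', hk', h0', h1'⟩ := ex_of_emod (x := a * 10) hr0
    have := Int.emod_lt_of_pos (b * 6) hr0
    have := Int.emod_lt_of_pos (b * 10) hr0
    generalize (a * 6) % r = x at *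
    generalize (a * 10) % r = y at *
    obtain ⟨v, hv, hv1⟩ : ∃ v, x = r - 2 * v ∧ (v = 1 ∨ v = 2) := ⟨(r - x) / 2, by omega, by omega⟩
    obtain ⟨t, ht, ht1, ht4⟩ : ∃ t, y = r - 2 * t ∧ 1 ≤ t ∧ t ≤ 4 :=
      ⟨(r - y) / 2, by omega, by omega, by omega⟩
    have key : r * (5 * (k + 1) - 3 * (k' + 1)) = 10 * v - 6 * t := by
      subst hv ht
      linear_combination -5 * hk + 3 * hk'
    generalize (5 * (k + 1) - 3 * (k' + 1)) = z at key
    have hrb : 100000 ≤ r := by omega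
    have hv2 : 1 ≤ v ∧ v ≤ 2 := by omega
    have hz : z = 0 := by
      have hz1 : z < 1 := by
        by_contra hc
        nlinarith
      have hz2 : -1 < z := by
        by_contra hc
        nlinarith
      omega
    subst hz
    omega
  · have c2 := h.carry 2 (2 * s) (r - 2) 0 0 (by omega) (by omega) (by omega) (by omega)
        (by omega) (by omega) (by omega) (by omega) (by omega)
    have p1 := par a
    have p2 := par b
    rw [mul_comm] at p1 p2
    have := Int.emod_lt_of_pos (b * 2) hr0
    have := Int.emod_lt_of_pos (a * 2) hr0
    omega

theorem fin_Q2 {r s a b l h : ℤ} (hc : Cfg r s (2 * s) a b 0) (hr : 13 < r) (hl : 2 ≤ l)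
    (hh : 1 ≤ h) (hrs : r = 2 * s + 2 + h) (hlh : l * h = s - 1) : False := by
  have hw : ∀ m : ℤ, 1 ≤ m → m * (2 * h + 4) ≤ r → ∃ P : ℤ, 2 ≤ P ∧ (P + 2) * (m * h) = r - 2 * (2 * m) := by
    intro m hm hmr
    exact hc.W (2 * m) (r - m * (h + 2)) (m * h) (m - 1) (by linarith) (by nlinarith) (by omega)
      (by rw [hrs]; ring) (by ring) (by nlinarith) (by linarith)
  obtain ⟨m, hm1, hm2⟩ : ∃ m : ℤ, m * (2 * h + 4) ≤ r ∧ r < (m + 1) * (2 * h + 4) :=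
    ⟨r / (2 * h + 4), Int.ediv_mul_le _ (by linarith), Int.lt_ediv_add_one_mul_self _ (by linarith)⟩
  have hr2 : r = (2 * l + 1) * h + 4 := by linarith
  have hm0 : 1 ≤ m := by
    by_contra hcon
    nlinarith
  obtain ⟨P, hP, hPe⟩ := hw m hm0 hm1
  have hb : 4 * m * (h + 1) ≤ r := by nlinarith [mul_nonneg (by linarith : 0 ≤ m) (by linarith : 0 ≤ h)]
  have hc1 : m * h < h + 2 := by nlinarith
  have hm3 : m < 4 := by nlinarith
  obtain rfl | rfl | rfl : m = 1 ∨ m = 2 ∨ m = 3 := by omega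
  · have hl3 : 5 * h + 4 ≤ r := by nlinarith
    have hh3 : h ≤ 3 := by linarith
    obtain rfl | rfl | rfl : h = 1 ∨ h = 2 ∨ h = 3 := by omega
    · omega
    · obtain rfl : l = 2 := by omega
      obtain rfl : s = 5 := by omega
      obtain rfl : r = 14 := by omega
      have c4 := hc.carry 4 6 12 1 2 (by omega) (by omega) (by omega) (by omega)
        (by omega) (by omega) (by omega) (by omega) (by omega)
      omega
    · obtain rfl : l = 2 := by omega
      obtain rfl : s = 7 := by omega
      obtain rfl : r = 19 := by omega
      have c4 := hc.carry 4 9 18 1 2 (by omega) (by omega) (by omega) (by omega)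
        (by omega) (by omega) (by omega) (by omega) (by omega)
      omega
  · obtain rfl : h = 1 := by omega
    omega
  · omega

/-- nonexceptional case -/
theorem core0 {r s e a b : ℤ} (h : Cfg r s e a b 0) (hr : 13 < r) (hs : 1 ≤ s)
    (hs2 : 2 * s ≤ r - 1) : False := by
  obtain ⟨q, hq, hqs, hd⟩ := h.base hr hs hs2 (by norm_num)
  replace h := h.congr_e hd
  obtain ⟨n, hn, hn1, hn2⟩ := exists_n r (q * s) (by nlinarith) (by linarith)
  obtain ⟨rfl, h1 | h1 | ⟨l, h', hl, hh, h1, h2⟩⟩ := h.G1 n hr hs hq hqs hn hn1 hn2 (by omega)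
  · subst h1
    exact kill_s1 (h.congr_e (by norm_num)) hr (Or.inl rfl)
  · exact kill_42 h hr (Or.inl rfl) h1
  · exact fin_Q2 h hr hl hh h1 h2


theorem small_mul {r z x : ℤ} (h : r * z = x) (h1 : x < r) (h2 : -r < x) : z = 0 := by
  have hz1 : z < 1 := by
    by_contra hc
    nlinarith
  have hz2 : -1 < z := by
    by_contra hc
    nlinarith
  omega

theorem X1 {r s a b j0 : ℤ} (h : Cfg r s (-1) a b j0) (hr : 100000 * j0 ≤ r) (hj : 1 ≤ j0)
    (hs : 1 ≤ s) (hs2 : 2 * s ≤ r - 1) : False := by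
  have hr0 : (0:ℤ) < r := by linarith
  by_cases hj1 : j0 = 1
  swap
  · have c := h.carry 1 s (r - 1) 0 (-1) (by omega) (by omega) (by omega) (by omega)
      (by omega) (by omega) (by omega) (by omega) (by omega)
    have := Int.emod_lt_of_pos (a * 1) hr0
    have := Int.emod_lt_of_pos (b * 1) hr0
    omega
  subst hj1
  by_cases h2 : 2 * s + 2 ≤ r
  · have c := h.carry 2 (2 * s) (r - 2) 0 (-1) (by omega) (by omega) (by omega) (by omega)
      (by omega) (by omega) (by omega) (by omega) (by omega)
    have t : ∀ x : ℤ, (x * 2) % r = r - 1 → ∃ m : ℤ, r = 2 * m + 1 ∧ (x * 3) % r = m - 1 ∧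
        (x * 5) % r = m - 2 := by
      intro x hx
      obtain ⟨k, hk, -, -⟩ := ex_of_emod (x := x * 2) hr0
      rw [hx] at hk
      rcases Int.even_or_odd' r with ⟨m, hm | hm⟩
      · exfalso
        have : x * 2 = 2 * m - 1 + 2 * (m * k) := by rw [hk, hm]; ring
        omega
      · rcases Int.even_or_odd' k with ⟨t, ht | ht⟩
        · refine ⟨m, hm, ?_, ?_⟩
          · have hx : x = m + r * t := by
              have : 2 * x = 2 * (m + r * t) := by rw [ht] at hk; linear_combination hk + hm
              linarith
            exact emod_of (1 + 3 * t) (by linear_combination 3 * hx - hm) (by omega) (by omega)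
          · have hx : x = m + r * t := by
              have : 2 * x = 2 * (m + r * t) := by rw [ht] at hk; linear_combination hk + hm
              linarith
            exact emod_of (2 + 5 * t) (by linear_combination 5 * hx - 2 * hm) (by omega) (by omega)
        · exfalso
          have : x * 2 = 2 * (2 * m + 2 * (m * t) + t) + 1 := by
            rw [hk, hm, ht]; ring
          omega
    have := Int.emod_lt_of_pos (a * 2) hr0
    have := Int.emod_lt_of_pos (b * 2) hr0
    obtain ⟨m, hm, ha3, ha5⟩ := t a (by omega)
    obtain ⟨m', hm', hb3, hb5⟩ := t b (by omega)
    by_cases h3 : 3 * s + 3 ≤ r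
    · have c := h.carry 3 (3 * s) (r - 3) 0 (-1) (by omega) (by omega) (by omega) (by omega)
        (by omega) (by omega) (by omega) (by omega) (by omega)
      omega
    by_cases h3' : r ≤ 3 * s
    · have c := h.carry 3 (3 * s - r) (r - 3) 1 (-1) (by omega) (by omega) (by omega) (by omega)
        (by omega) (by omega) (by omega) (by omega) (by omega)
      omega
    · have c := h.carry 5 (5 * s - r) (r - 5) 1 (-1) (by omega) (by omega) (by omega) (by omega)
        (by omega) (by omega) (by omega) (by omega) (by omega)
      omega
  · have c3 := h.carry 3 (s - 1) (r - 3) 1 (-1) (by omega) (by omega) (by omega) (by omega)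
      (by omega) (by omega) (by omega) (by omega) (by omega)
    have c5 := h.carry 5 (s - 2) (r - 5) 2 (-1) (by omega) (by omega) (by omega) (by omega)
      (by omega) (by omega) (by omega) (by omega) (by omega)
    obtain ⟨k, hk, h0, h1⟩ := ex_of_emod (x := a * 3) hr0
    obtain ⟨k', hk', h0', h1'⟩ := ex_of_emod (x := a * 5) hr0
    have := Int.emod_lt_of_pos (b * 3) hr0
    have := Int.emod_lt_of_pos (b * 5) hr0
    generalize (a * 3) % r = x at *
    generalize (a * 5) % r = y at *
    have key : r * (5 * (k + 1) - 3 * (k' + 1)) = 5 * (r - x) - 3 * (r - y) := by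
      linear_combination -5 * hk + 3 * hk'
    have := small_mul key (by omega) (by omega)
    rw [this] at key
    omega

theorem X2mid {r s a b j0 : ℤ} (h : Cfg r s (2 * s) a b j0) (hr : 100000 ≤ r)
    (h1 : r < 12 * s) (h2 : 40 * s + 40 < 19 * r) (h4 : r ≠ 4 * s + 2) : False := by
  by_cases hi92 : 1000 * s < 92 * r
  · have w7 := h.W4 7 0 (by norm_num) (by linarith)
    have w8 := h.W4 8 0 (by norm_num) (by linarith)
    omega
  by_cases hi106 : 1000 * s < 106 * r
  · have w6 := h.W4 6 0 (by norm_num) (by linarith)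
    have w7 := h.W4 7 0 (by norm_num) (by linarith)
    omega
  by_cases hi123 : 1000 * s < 123 * r
  · have w5 := h.W4 5 0 (by norm_num) (by linarith)
    have w6 := h.W4 6 0 (by norm_num) (by linarith)
    omega
  by_cases hi133 : 1000 * s < 133 * r
  · have w5 := h.W4 5 0 (by norm_num) (by linarith)
    have w13 := h.W4 13 1 (by norm_num) (by linarith)
    omega
  by_cases hi148 : 1000 * s < 148 * r
  · have w4 := h.W4 4 0 (by norm_num) (by linarith)
    have w5 := h.W4 5 0 (by norm_num) (by linarith)
    omega
  by_cases hi160 : 1000 * s < 160 * r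
  · have w4 := h.W4 4 0 (by norm_num) (by linarith)
    have w17 := h.W4 17 2 (by norm_num) (by linarith)
    omega
  by_cases hi173 : 1000 * s < 173 * r
  · have w4 := h.W4 4 0 (by norm_num) (by linarith)
    have w10 := h.W4 10 1 (by norm_num) (by linarith)
    omega
  by_cases hi199 : 1000 * s < 199 * r
  · have w3 := h.W4 3 0 (by norm_num) (by linarith)
    have w4 := h.W4 4 0 (by norm_num) (by linarith)
    have w9 := h.W4 9 1 (by norm_num) (by linarith)
    omega
  by_cases hi217 : 1000 * s < 217 * r
  · have w3 := h.W4 3 0 (by norm_num) (by linarith)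
    have w8 := h.W4 8 1 (by norm_num) (by linarith)
    omega
  by_cases hi256 : 1000 * s < 256 * r
  · have w3 := h.W4 3 0 (by norm_num) (by linarith)
    have w7 := h.W4 7 1 (by norm_num) (by linarith)
    omega
  by_cases hi290 : 1000 * s < 290 * r
  · have w2 := h.W4 2 0 (by norm_num) (by linarith)
    have w6 := h.W4 6 1 (by norm_num) (by linarith)
    omega
  by_cases hi304 : 1000 * s < 304 * r
  · have w2 := h.W4 2 0 (by norm_num) (by linarith)
    have w9 := h.W4 9 2 (by norm_num) (by linarith)
    omega
  by_cases hi348 : 1000 * s < 348 * r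
  · have w2 := h.W4 2 0 (by norm_num) (by linarith)
    have w5 := h.W4 5 1 (by norm_num) (by linarith)
    omega
  by_cases hi364 : 1000 * s < 364 * r
  · have w2 := h.W4 2 0 (by norm_num) (by linarith)
    have w13 := h.W4 13 4 (by norm_num) (by linarith)
    omega
  by_cases hi373 : 1000 * s < 373 * r
  · have w2 := h.W4 2 0 (by norm_num) (by linarith)
    have w7 := h.W4 7 2 (by norm_num) (by linarith)
    omega
  by_cases hi386 : 1000 * s < 386 * r
  · have w2 := h.W4 2 0 (by norm_num) (by linarith)
    have w7 := h.W4 7 2 (by norm_num) (by linarith)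
    have w15 := h.W4 15 5 (by norm_num) (by linarith)
    omega
  by_cases hi399 : 1000 * s < 399 * r
  · have w2 := h.W4 2 0 (by norm_num) (by linarith)
    have w4 := h.W4 4 1 (by norm_num) (by linarith)
    omega
  by_cases hi415 : 1000 * s < 415 * r
  · have w4 := h.W4 4 1 (by norm_num) (by linarith)
    have w9 := h.W4 9 3 (by norm_num) (by linarith)
    omega
  by_cases hi430 : 1000 * s < 430 * r
  · have w4 := h.W4 4 1 (by norm_num) (by linarith)
    have w11 := h.W4 11 4 (by norm_num) (by linarith)
    omega
  by_cases hi445 : 1000 * s < 445 * r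
  · have w4 := h.W4 4 1 (by norm_num) (by linarith)
    have w6 := h.W4 6 2 (by norm_num) (by linarith)
    have w13 := h.W4 13 5 (by norm_num) (by linarith)
    omega
  by_cases hi457 : 1000 * s < 457 * r
  · have w6 := h.W4 6 2 (by norm_num) (by linarith)
    have w8 := h.W4 8 3 (by norm_num) (by linarith)
    omega
  by_cases hi467 : 1000 * s < 467 * r
  · have w8 := h.W4 8 3 (by norm_num) (by linarith)
    have w10 := h.W4 10 4 (by norm_num) (by linarith)
    omega
  · have w12 := h.W4 12 5 (by norm_num) (by linarith)
    have w14 := h.W4 14 6 (by norm_num) (by linarith)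
    omega

theorem X2low {r s a b j0 : ℤ} (h : Cfg r s (2 * s) a b j0) (hr : 100000 ≤ r)
    (h1 : 12 * s ≤ r) (h2 : 2 ≤ s) : False := by
  have key : ∀ j : ℤ, 1 ≤ j → j ≠ j0 → r ≤ 2 * (j * s) → 2 * (j * (2 * s + 1)) < 3 * r → False := by
    intro j hj hj0 ha hb
    have hjs : 2 * j ≤ j * s := by nlinarith
    have := h.W4 j 0 hj (by linarith)
    rcases this with h | h | h | h | h
    · exact hj0 h
    all_goals linarith
  obtain ⟨n, hn, hn1, hn2⟩ := exists_n r (2 * s) (by linarith) (by linarith)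
  have hc : 2 * ((n + 2) * (2 * s + 1)) < 3 * r := by
    rcases le_or_gt (20 * s) r with h3 | h3
    · nlinarith
    · nlinarith
  by_cases hj : n + 1 = j0
  · exact key (n + 2) (by linarith) (by omega) (by linarith) hc
  · exact key (n + 1) (by linarith) hj (by linarith) (by linarith)

theorem X2high {r s a b j0 h : ℤ} (hc : Cfg r s (2 * s) a b j0) (hr : 100000 ≤ r)
    (h1 : 20 * h ≤ r) (h2 : 1 ≤ h) (hrs : r = 2 * s + 2 + h) : False := by
  have key : ∀ m : ℤ, 1 ≤ m → 2 * m ≠ j0 → 2 * (m * (h + 2)) ≤ r → r < 4 * (m * (h + 1)) → False := by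
    intro m hm hj0 hmr hmr2
    obtain ⟨P, hP, hPe⟩ := hc.W (2 * m) (r - m * (h + 2)) (m * h) (m - 1) (by linarith) (by nlinarith) hj0
      (by rw [hrs]; ring) (by ring) (by nlinarith) (by linarith)
    have : 0 ≤ m * h := by nlinarith
    nlinarith
  obtain ⟨n, hn, hn1, hn2⟩ := exists_n (r + 1) (4 * (h + 1)) (by linarith) (by linarith)
  have hb : 2 * ((n + 2) * (h + 2)) ≤ r := by nlinarith
  by_cases hj : 2 * (n + 1) = j0
  · exact key (n + 2) (by linarith) (by omega) hb (by linarith)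
  · exact key (n + 1) (by linarith) hj (by linarith) (by linarith)

theorem X2 {r s a b j0 : ℤ} (h : Cfg r s (2 * s) a b j0) (hr : 100000 * j0 ≤ r) (hj : 1 ≤ j0)
    (hs : 1 ≤ s) (hs2 : 2 * s ≤ r - 2) : False := by
  by_cases hs1 : s = 1
  · subst hs1
    exact kill_s1 (h.congr_e (by norm_num)) (by linarith) (Or.inr ⟨hj, hr⟩)
  by_cases h4 : r = 4 * s + 2
  · exact kill_42 h (by linarith) (Or.inr ⟨hj, hr⟩) h4
  by_cases h0 : r = 2 * s + 2
  · by_cases hj4 : j0 = 4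
    · obtain ⟨P, hP, hPe⟩ := h.W 6 (r - 6) 0 2 (by omega) (by omega) (by omega) (by omega) (by omega)
        (by omega) (by omega)
      omega
    · obtain ⟨P, hP, hPe⟩ := h.W 4 (r - 4) 0 1 (by omega) (by omega) (by omega) (by omega) (by omega)
        (by omega) (by omega)
      omega
  rcases le_or_gt (12 * s) r with h1 | h1
  · exact X2low h (by linarith) h1 (by omega)
  rcases le_or_gt (20 * (r - 2 * s - 2)) r with h2 | h2
  · exact X2high h (by linarith) h2 (by omega) (by ring)
  · exact X2mid h (by linarith) h1 (by linarith) h4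


theorem X3 {r s q a b j0 : ℤ} (h : Cfg r s (q * s) a b j0) (hr : 100000 * j0 ≤ r) (hj : 1 ≤ j0)
    (hs : 1 ≤ s) (hq : 3 ≤ q) (hqs : q * s ≤ r - 2) : False := by
  have hqs3 : 3 * s ≤ q * s := by nlinarith
  obtain ⟨n, hn, hn1, hn2⟩ := exists_n r (q * s) (by nlinarith) (by linarith)
  by_cases hnj : n + 1 = j0
  swap
  · have := (h.G1 n (by linarith) hs (by linarith) hqs hn hn1 hn2 hnj).1
    omega
  subst hnj
  rcases le_or_gt 3 n with h3 | h3
  · have e1 : 3 * (q * s) ≤ n * (q * s) := by nlinarith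
    have e2 : n * (3 * s) ≤ n * (q * s) := by nlinarith
    have e3 : 3 * s ≤ n * s := by nlinarith
    obtain ⟨l, P, U, hP, hU, hPU, hPl, hl⟩ := h.G (n + 2) 1 (by linarith) hs (by linarith)
      (by omega) (by nlinarith) (by linarith) (by linarith)
    have hl1 : 1 ≤ l := by
      by_contra hc
      have : l ≤ 0 := by omega
      nlinarith
    have hC : 0 ≤ r - (n + 2) * (s + 1) := by nlinarith
    have hUs : 0 ≤ U * s := by positivity
    have hb : r ≤ q * s + (n + 1) * s + n + 1 := by nlinarith
    nlinarith
  obtain rfl | rfl : n = 1 ∨ n = 2 := by omega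
  · by_cases h33 : 3 * (s + 1) ≤ r
    · by_cases hi : 3 * (q * s) < 2 * r
      · obtain ⟨l, P, U, hP, hU, hPU, hPl, hl⟩ := h.G 3 1 (by linarith) hs (by linarith)
          (by omega) h33 (by linarith) (by linarith)
        have hl1 : 1 ≤ l := by omega
        have hUs : 0 ≤ U * s := by positivity
        rcases eq_or_lt_of_le hl1 with h1 | h1
        · subst h1
          have hrr : r = q * s - U * s + 2 * s + 2 := by linarith
          have hsb : 16000 ≤ s := by linarith
          have hq4 : q ≤ 4 := by
            by_contra hc
            have : 5 ≤ q := by omega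
            nlinarith
          have hU0 : U = 0 := by
            by_contra hc
            have : 1 ≤ U := by omega
            nlinarith
          subst hU0
          obtain rfl | rfl : q = 3 ∨ q = 4 := by omega
          · exact h.no 7 (2 * s - 2) (3 * s - 3) (s - 8) 1 4 (by omega) (by omega) (by omega) (by omega)
              (by omega) (by omega) (by omega) (by omega) (by omega) (by omega) (by omega) (by omega)
          · exact h.no 8 (2 * s - 2) (4 * s - 4) (2 * s - 10) 1 5 (by omega) (by omega) (by omega) (by omega)
              (by omega) (by omega) (by omega) (by omega) (by omega) (by omega) (by omega) (by omega)
        · have hl2 : 2 ≤ l := h1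
          have : 2 * r ≤ q * s + 5 * s + 5 := by nlinarith
          nlinarith
      · obtain ⟨l, P, U, hP, hU, hPU, hPl, hl⟩ := h.G 3 2 (by linarith) hs (by linarith)
          (by omega) h33 (by linarith) (by linarith)
        have hl1 : 1 ≤ l := by omega
        have hUs : 0 ≤ U * s := by positivity
        rcases eq_or_lt_of_le hl1 with h1 | h1
        · subst h1
          have : s ≤ U * s := by nlinarith
          linarith
        · have hl2 : 2 ≤ l := h1
          have hb : 2 * r ≤ q * s + 4 * s + 4 := by nlinarith
          have hq4 : q ≤ 4 := by
            by_contra hc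
            have : 5 ≤ q := by omega
            nlinarith
          obtain rfl | rfl : q = 3 ∨ q = 4 := by omega
          · have hU0 : U = 0 := by
              by_contra hc
              have : 1 ≤ U := by omega
              nlinarith
            subst hU0
            obtain ⟨C, hC⟩ : ∃ C, r = 3 * s + 3 + C := ⟨r - 3 * s - 3, by ring⟩
            have hlC : l * C = s - 2 := by
              rw [hC] at hl; linarith
            have hC0 : 0 ≤ C := by linarith
            have h2C : 2 * C ≤ s - 2 := by nlinarith
            obtain ⟨P', U', hP', hU', hPU', he, -⟩ := h.ex 5 (2 * s - 3 - C) (s + 1 + 2 * C)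
              (3 * s - 12 - 4 * C) 1 4 (by omega) (by omega) (by omega) (by omega)
              (by omega) (by omega) (by omega) (by omega) (by omega) (by omega)
            have hU0 : U' = 0 := pu_U0 hP' hU' hPU' he (by omega) (by omega) (by omega) (by omega)
            subst hU0
            have hP2 : P' = 2 := by
              by_contra hc
              have : 3 ≤ P' := by omega
              nlinarith
            subst hP2
            have hs14 : s = 14 + 8 * C := by linarith
            have hC1 : 1 ≤ C := by omega
            have h12 : (l - 8) * C = 12 := by linarith
            have hl9 : 1 ≤ l - 8 := by
              by_contra hc
              nlinarith
            nlinarith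
          · have hr4 : r = 4 * s + 2 := by omega
            exact h.no 6 (2 * s - 2) (2 * s - 2) (4 * s - 10) 1 5 (by omega) (by omega) (by omega) (by omega)
              (by omega) (by omega) (by omega) (by omega) (by omega) (by omega) (by omega) (by omega)
    · have hq3 : q = 3 := by
        by_contra hc
        have : 4 ≤ q := by omega
        nlinarith
      subst hq3
      have hr3 : r = 3 * s + 2 := by omega
      obtain ⟨P', U', hP', hU', hPU', he, -⟩ := h.ex 5 (2 * s - 2) (s - 1)
              (3 * s - 8) 1 4 (by omega) (by omega) (by omega) (by omega)
              (by omega) (by omega) (by omega) (by omega) (by omega) (by omega)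
      have hU0 : U' = 0 := pu_U0 hP' hU' hPU' he (by omega) (by omega) (by omega) (by omega)
      subst hU0
      have hP2 : P' = 2 := by
        by_contra hc
        have : 3 ≤ P' := by omega
        nlinarith
      subst hP2
      omega
  · obtain ⟨l, P, U, hP, hU, hPU, hPl, hl⟩ := h.G 4 1 (by linarith) hs (by linarith)
      (by omega) (by linarith) (by linarith) (by linarith)
    have hl1 : 1 ≤ l := by omega
    have hUs : 0 ≤ U * s := by positivity
    have hb : r ≤ q * s + 3 * s + 3 := by nlinarith
    have hq3 : q = 3 := by
      by_contra hc
      have : 4 ≤ q := by omega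
      nlinarith
    subst hq3
    have hr6 : r = 6 * s + 3 := by
      by_contra hc
      rcases eq_or_lt_of_le hl1 with h1 | h1
      · subst h1
        have hU0 : U = 0 := by
          by_contra hc
          have : 1 ≤ U := by omega
          nlinarith
        subst hU0
        omega
      · have hl2 : 2 ≤ l := h1
        nlinarith
    exact h.no 9 (3 * s - 3) (3 * s - 3) (3 * s - 12) 1 4 (by omega) (by omega) (by omega) (by omega)
              (by omega) (by omega) (by omega) (by omega) (by omega) (by omega) (by omega) (by omega)

theorem Cfg.G' {r s h p a b j0 : ℤ} (hc : Cfg r s (-(p * (1 + s))) a b j0) (m : ℤ) (hr : 13 < r)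
    (hs : 1 ≤ s) (hh : 1 ≤ h) (hrs : r = 2 * s + 2 + h) (hm : 1 ≤ m) (hj : 2 * m ≠ j0)
    (hjr : m * (h + 2) ≤ r) (hi1 : r ≤ m * (p * h)) (hi2 : m * (p * h) < 2 * r) :
    ∃ l P U : ℤ, 0 ≤ P ∧ 0 ≤ U ∧ 2 ≤ P + U ∧ U = m * l - 1 ∧
      l * (r - m * (h + 2)) = (p - P - 1) * h - 2 ∧ r ∣ P * (1 + s) - U * s + -(p * (1 + s)) := by
  have hmh : m ≤ m * h := by nlinarith
  obtain ⟨P, U, hP, hU, hPU, he, L, hL⟩ := hc.ex (2 * m) (r - m * (h + 2)) (m * h)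
    (m * (p * h) - r) (m - 1) (1 - m * p)
    (by linarith) (by nlinarith) hj (by rw [hrs]; ring) (by linarith) (by ring) (by linarith)
    (by rw [hrs]; ring) (by linarith) (by linarith)
  have h0 : (P - U - p - 2 * L) * r = -(U * (h + 2) + (p - P) * h) := by
    have h2 : 2 * s = r - 2 - h := by linarith
    linear_combination 2 * hL + (P - U - p) * hrs
  have h1 : U = m * -(P - U - p - 2 * L) - 1 := by
    have : r * U = r * (m * -(P - U - p - 2 * L) - 1) := by
      linear_combination he + m * h0
    exact mul_left_cancel₀ (by linarith) this
  refine ⟨-(P - U - p - 2 * L), P, U, hP, hU, hPU, h1, ?_, ⟨L, hL⟩⟩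
  generalize hl : -(P - U - p - 2 * L) = l at *
  have : P - U - p - 2 * L = -l := by linarith
  rw [this] at h0
  subst h1
  linear_combination -h0

set_option maxHeartbeats 1000000 in
theorem X5 {r s h p a b : ℤ} (hc : Cfg r s (-(p * (1 + s))) a b 1) (hr : 100000 ≤ r)
    (hs : 1 ≤ s) (hh : 1 ≤ h) (hrs : r = 2 * s + 2 + h) (hp : 3 ≤ p) (hph : p * h ≤ r - 2) :
    False := by
  by_cases h13 : h = 1 ∧ p = 3
  · obtain ⟨rfl, rfl⟩ := h13
    exact hc.no 3 (s - 3) (s + 3) (s + 6) 1 (-5) (by omega) (by omega) (by omega) (by omega)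
              (by omega) (by omega) (by omega) (by omega) (by omega) (by omega) (by omega) (by omega)
  have hph3 : 3 * h ≤ p * h := by nlinarith
  obtain ⟨n, hn, hn1, hn2⟩ := exists_n r (p * h) (by nlinarith) (by linarith)
  have e2 : n * (3 * h) ≤ n * (p * h) := by nlinarith
  have hjr : (n + 1) * (h + 2) ≤ r := by
    rcases eq_or_lt_of_le hn with h1 | h1
    · subst h1; linarith
    · have h2 : 2 ≤ n := h1
      by_cases hh1 : h = 1
      · subst hh1
        have : 4 ≤ p := by omega
        nlinarith
      · have : 2 ≤ h := by omega
        nlinarith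
  obtain ⟨l, P, U, hP, hU, hPU, hUl, hl, hdv⟩ := hc.G' (n + 1) (by linarith) hs hh hrs (by linarith)
    (by omega) hjr (by linarith) (by linarith)
  have hl1 : 1 ≤ l := by
    by_contra hc
    have : l ≤ 0 := by omega
    nlinarith
  have hPh : 0 ≤ P * h := by positivity
  have hC : 0 ≤ r - (n + 1) * (h + 2) := by linarith
  rcases le_or_gt 3 n with h3 | h3
  · have hb : r ≤ p * h + n * h + 2 * n := by nlinarith
    by_cases hh1 : h = 1
    · subst hh1
      have hp4 : 4 ≤ p := by omega
      have : (n - 1) * (p - 3) ≤ 2 := by nlinarith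
      have hp5 : p ≤ 4 := by nlinarith
      have hp6 : n ≤ 3 := by nlinarith
      linarith
    · have h2 : 2 ≤ h := by omega
      nlinarith
  obtain rfl | rfl : n = 1 ∨ n = 2 := by omega
  · rcases eq_or_lt_of_le hl1 with h1 | h1
    · subst h1
      have hU1 : U = 1 := by omega
      have hP1 : P = 1 := by
        by_contra hc
        have : 2 ≤ P := by omega
        nlinarith
      subst hU1 hP1
      exact X1 (hc.congr_e (e' := -1) (by
        have : -(p * (1 + s)) - -1 = 1 * (1 + s) - 1 * s + -(p * (1 + s)) := by ring
        rw [this]; exact hdv)) (by linarith) le_rfl hs (by linarith)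
    · have hl2 : 2 ≤ l := h1
      have hb : 2 * r ≤ p * h + 3 * h + 6 := by nlinarith
      have hp3 : p = 3 := by
        by_contra hc
        have : 4 ≤ p := by omega
        nlinarith
      subst hp3
      have h2C := mul_le_mul_of_nonneg_right hl2 hC
      have hP0 : P = 0 := by
        by_contra hc
        have : 1 ≤ P := by omega
        have : 1 * h ≤ P * h := mul_le_mul_of_nonneg_right this (by linarith)
        linarith
      subst hP0
      have hr3 : r = 3 * h + 2 ∨ r = 3 * h + 4 := by omega
      rcases eq_or_lt_of_le hl2 with h5 | h5
      · subst h5; omega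
      · have h3 : 3 ≤ l := h5
        have h3C := mul_le_mul_of_nonneg_right h3 hC
        linarith
  · have hb : r ≤ p * h + 2 * h + 4 := by linarith [mul_le_mul_of_nonneg_right hl1 hC]
    linarith

theorem X6 {r s h a b : ℤ} (hc : Cfg r s (-(2 * (1 + s))) a b 1) (hr : 100000 ≤ r)
    (hs : 1 ≤ s) (hh : 1 ≤ h) (hrs : r = 2 * s + 2 + h) (hph : 2 * h ≤ r - 2) :
    False := by
  have hc1 : Cfg r s h a b 1 := hc.congr_e ⟨-1, by rw [hrs]; ring⟩
  rcases lt_or_ge (6 * h + 6) r with h6 | h6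
  · exact hc1.no 3 (3 * s - r) (2 * r - 3 * s - 3) (3 * h) 1 0 (by omega) (by omega) (by omega) (by omega)
              (by omega) (by omega) (by omega) (by omega) (by omega) (by omega) (by omega) (by omega)
  by_cases h42 : r = 4 * s + 2
  · exact kill_42 (hc1.congr_e (e' := 2 * s) ⟨0, by omega⟩) (by linarith) (Or.inr ⟨le_rfl, by linarith⟩) h42
  have hw : Cfg r (r - 1 - s) (2 * (r - 1 - s)) a b 1 := hc.swap.congr_e ⟨-2, by ring⟩
  obtain ⟨c, hcs⟩ : ∃ c, c = r - 1 - s := ⟨_, rfl⟩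
  rw [← hcs] at hw
  have b1 : 7 * r ≤ 12 * c + 6 := by omega
  have b2 : 4 * c ≤ 3 * r - 2 := by omega
  have b3 : 4 * c ≠ 3 * r - 2 := by omega
  clear hc1 hc h42 hph h6 hrs
  by_cases h1 : 1000 * c < 599 * r
  · have w1 := hw.W4 3 1 (by norm_num) (by linarith)
    have w2 := hw.W4 8 4 (by norm_num) (by linarith)
    omega
  by_cases h1 : 1000 * c < 632 * r
  · have w1 := hw.W4 6 3 (by norm_num) (by linarith)
    have w2 := hw.W4 9 5 (by norm_num) (by linarith)
    omega
  by_cases h1 : 1000 * c < 640 * r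
  · have w1 := hw.W4 4 2 (by norm_num) (by linarith)
    omega
  by_cases h1 : 1000 * c < 685 * r
  · have w1 := hw.W4 4 2 (by norm_num) (by linarith)
    omega
  by_cases h1 : 1000 * c < 705 * r
  · have w1 := hw.W4 4 2 (by norm_num) (by linarith)
    have w2 := hw.W4 11 7 (by norm_num) (by linarith)
    have w3 := hw.W4 5 3 (by norm_num) (by linarith)
    omega
  · have w1 := hw.W4 5 3 (by norm_num) (by linarith)
    omega

theorem X4 {r s e a b : ℤ} (h : Cfg r s e a b 1) (hr : 100000 ≤ r)
    (hs : 1 ≤ s) (hs2 : 2 * s ≤ r - 1) : False := by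
  have hr0 : (0:ℤ) < r := by linarith
  have x1 : r ∣ 1 + e → False := fun hd => X1 (h.congr_e (e' := -1) (by
    rw [show e - -1 = 1 + e by ring]; exact hd)) (by linarith) le_rfl hs hs2
  by_cases h1 : r = 2 * s + 1
  · have hE0 := Int.emod_nonneg (3 * e) hr0.ne'
    have hE1 := Int.emod_lt_of_pos (3 * e) hr0
    have hdm := Int.emod_add_mul_ediv (3 * e) r
    obtain ⟨P, U, hP, hU, hPU, he, L, hL⟩ := h.ex 3 (s - 1) (s - 1) ((3 * e) % r) 1 (3 * e / r)
      (by omega) (by omega) (by omega) (by omega) (by omega) (by omega) (by omega) (by linarith)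
      hE0 hE1
    have h2 : P + U = 2 := by
      by_contra hc
      have : 3 ≤ P + U := by omega
      nlinarith
    apply x1
    obtain rfl : U = 2 - P := by linarith
    exact ⟨L + 1 - P, by linear_combination hL - (1 - P) * h1⟩
  by_cases h2 : r = 2 * s + 2
  · have hE0 := Int.emod_nonneg (3 * e) hr0.ne'
    have hE1 := Int.emod_lt_of_pos (3 * e) hr0
    have hdm := Int.emod_add_mul_ediv (3 * e) r
    obtain ⟨P, U, hP, hU, hPU, he, L, hL⟩ := h.ex 3 (s - 2) (s + 1) ((3 * e) % r) 1 (3 * e / r)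
      (by omega) (by omega) (by omega) (by omega) (by omega) (by omega) (by omega) (by linarith)
      hE0 hE1
    have hU2 : 0 ≤ U * (s - 2) := mul_nonneg hU (by omega)
    have hP2 : P < 2 := by
      by_contra hc
      nlinarith
    obtain rfl | rfl : P = 0 ∨ P = 1 := by omega
    · have : U = 2 := by
        by_contra hc
        have : 3 ≤ U := by omega
        nlinarith
      subst this
      exact X2 (h.congr_e (e' := 2 * s) ⟨L, by linarith⟩) (by linarith) le_rfl hs (by linarith)
    · have : U = 1 := by
        by_contra hc
        have : 2 ≤ U := by omega
        nlinarith
      subst this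
      exact x1 ⟨L, by linarith⟩
  have hE0 := Int.emod_nonneg (2 * e) hr0.ne'
  have hE1 := Int.emod_lt_of_pos (2 * e) hr0
  have hdm := Int.emod_add_mul_ediv (2 * e) r
  obtain ⟨P, U, hP, hU, hPU, he, L, hL⟩ := h.ex 2 (2 * s) (r - 2 - 2 * s) ((2 * e) % r) 0 (2 * e / r)
      (by omega) (by omega) (by omega) (by omega) (by omega) (by omega) (by omega) (by linarith)
      hE0 hE1
  have hc := h.carry 2 (2 * s) ((2 * e) % r) 0 (2 * e / r)
      (by omega) (by omega) (by omega) (by omega) (by omega) (by omega) (by linarith)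
      hE0 hE1
  have := Int.emod_lt_of_pos (a * 2) hr0
  have := Int.emod_lt_of_pos (b * 2) hr0
  obtain ⟨h', hh'⟩ : ∃ h', h' = r - 2 - 2 * s := ⟨_, rfl⟩
  rw [← hh'] at he
  have hh1 : 1 ≤ h' := by omega
  rcases eq_or_lt_of_le hP with hP0 | hP0
  · subst hP0
    have hUs : U * s ≤ r - 2 := by nlinarith
    have h' := h.congr_e (e' := U * s) ⟨L, by linarith⟩
    rcases eq_or_lt_of_le hPU with h5 | h5
    · obtain rfl : U = 2 := by linarith
      exact X2 h' (by linarith) le_rfl hs (by linarith)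
    · exact X3 h' (by linarith) le_rfl hs (by linarith) hUs
  rcases eq_or_lt_of_le hU with hU0 | hU0
  · subst hU0
    have hPs : P * h' ≤ r - 2 := by linarith
    have h5 := h.congr_e (e' := -(P * (1 + s))) ⟨L, by linarith⟩
    rcases eq_or_lt_of_le hPU with h6 | h6
    · obtain rfl : P = 2 := by linarith
      exact X6 h5 hr hs hh1 (by linarith) hPs
    · exact X5 h5 hr hs hh1 (by linarith) (by linarith) hPs
  · have hP1 : P = 1 := by nlinarith
    subst hP1
    have hU1 : U = 1 := by nlinarith
    subst hU1
    exact x1 ⟨L, by linarith⟩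

theorem core1 {r s e a b j0 : ℤ} (h : Cfg r s e a b j0) (hr : 13 < r) (hs : 1 ≤ s)
    (hs2 : 2 * s ≤ r - 1) (hj : j0 = 0 ∨ (1 ≤ j0 ∧ 100000 * j0 ≤ r)) : False := by
  rcases hj with rfl | ⟨hj, hjr⟩
  · exact core0 h hr hs hs2
  by_cases h1 : j0 = 1
  · subst h1
    exact X4 h (by linarith) hs hs2
  obtain ⟨q, hq, hqs, hd⟩ := h.base hr hs hs2 (Ne.symm h1)
  replace h := h.congr_e hd
  rcases eq_or_lt_of_le hq with h5 | h5
  · subst h5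
    exact X2 h hjr hj hs hqs
  · exact X3 h hjr hj hs h5 hqs

theorem core_s15 {r s e a b j0 : ℤ} (h : Cfg r s e a b j0) (hr : 13 < r) (hs : 1 ≤ s)
    (hs2 : s ≤ r - 2) (hj : j0 = 0 ∨ (1 ≤ j0 ∧ 100000 * j0 ≤ r)) : False := by
  rcases le_or_gt (2 * s) (r - 1) with h1 | h1
  · exact core1 h hr hs h1 hj
  · exact core1 h.swap hr (by linarith) (by linarith) hj

def vec (A B C D r : ℤ) : Fin 4 → ℚ := ![(A:ℚ) / r, (B:ℚ) / r, (C:ℚ) / r, (D:ℚ) / r]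

def TT (A B C D : ℤ) (m : Fin 4 → ℕ) : ℤ := (m 0 : ℤ) * A + (m 1 : ℤ) * B + (m 2 : ℤ) * C + (m 3 : ℤ) * D

theorem vec_sum (A B C D r : ℤ) (m : Fin 4 → ℕ) :
    ∑ i : Fin 4, (m i : ℝ) * ((vec A B C D r i : ℚ) : ℝ) = (TT A B C D m : ℝ) / r := by
  simp [vec, TT, Fin.sum_univ_four]
  ring

theorem vec_w (A B C D r : ℤ) : ((w (vec A B C D r) : ℚ) : ℝ) = ((A + B + C + D : ℤ) : ℝ) / r := by
  simp [vec, w, Fin.sum_univ_four]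
  ring

theorem vf_lt {A B C D r : ℤ} {S : Set (Fin 4 → ℕ)} (hS : S.Nonempty) {x : ℝ}
    (h : vf S (vec A B C D r) < x) : ∃ m ∈ S, (TT A B C D m : ℝ) / r < x := by
  obtain ⟨m0, hm0⟩ := hS
  obtain ⟨y, ⟨m, hm, rfl⟩, hy⟩ := exists_lt_of_csInf_lt
    (s := {x : ℝ | ∃ m ∈ S, x = ∑ i : Fin 4, (m i : ℝ) * ((vec A B C D r i : ℚ) : ℝ)})
    ⟨_, m0, hm0, rfl⟩ h
  exact ⟨m, hm, by rw [← vec_sum]; exact hy⟩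

theorem vf_le {A B C D r : ℤ} {S : Set (Fin 4 → ℕ)} (hr : 0 < r) (hA : 0 ≤ A) (hB : 0 ≤ B)
    (hC : 0 ≤ C) (hD : 0 ≤ D) {m : Fin 4 → ℕ} (hm : m ∈ S) :
    vf S (vec A B C D r) ≤ (TT A B C D m : ℝ) / r := by
  apply csInf_le
  · refine ⟨0, ?_⟩
    rintro x ⟨m, -, rfl⟩
    rw [vec_sum]
    have : 0 ≤ TT A B C D m := by unfold TT; positivity
    have h2 : (0:ℝ) ≤ (TT A B C D m : ℝ) := by exact_mod_cast this
    have h3 : (0:ℝ) < (r : ℝ) := by exact_mod_cast hr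
    positivity
  · exact ⟨m, hm, (vec_sum ..).symm⟩

theorem vec_mem {A B C D r a b c d : ℤ} (j : ℤ) (hr : 0 < r) (hA : 0 ≤ A) (hB : 0 ≤ B)
    (hC : 0 ≤ C) (hD : 0 ≤ D) (ha : r ∣ A - j * a) (hb : r ∣ B - j * b) (hc : r ∣ C - j * c)
    (hd : r ∣ D - j * d) : vec A B C D r ∈ latN r a b c d ∩ orth := by
  have hrq : (0:ℚ) < (r : ℚ) := by exact_mod_cast hr
  constructor
  · obtain ⟨x, hx⟩ := ha
    obtain ⟨y, hy⟩ := hb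
    obtain ⟨z, hz⟩ := hc
    obtain ⟨t, ht⟩ := hd
    obtain rfl : A = j * a + r * x := by linarith
    obtain rfl : B = j * b + r * y := by linarith
    obtain rfl : C = j * c + r * z := by linarith
    obtain rfl : D = j * d + r * t := by linarith
    refine ⟨j, ![x, y, z, t], ?_⟩
    intro i
    fin_cases i <;> simp [vec] <;> field_simp
  · intro i
    have h1 : (0:ℚ) ≤ A := by exact_mod_cast hA
    have h2 : (0:ℚ) ≤ B := by exact_mod_cast hB
    have h3 : (0:ℚ) ≤ C := by exact_mod_cast hC
    have h4 : (0:ℚ) ≤ D := by exact_mod_cast hD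
    fin_cases i <;> simp [vec] <;> positivity

theorem vec_cd (A B C D r : ℤ) : vec A B C D r 2 + vec A B C D r 3 = ((C + D : ℤ) : ℚ) / r := by
  simp [vec]; ring

theorem vec_corner {A B C D r : ℤ} (hr : 0 < r) (h0 : 0 < C + D) (h1 : C + D < r) :
    vec A B C D r ∉ corners := by
  have hrq : (0:ℚ) < (r : ℚ) := by exact_mod_cast hr
  have h0' : (0:ℚ) < ((C + D : ℤ) : ℚ) := by exact_mod_cast h0
  have h1' : ((C + D : ℤ) : ℚ) < r := by exact_mod_cast h1
  have hs := vec_cd A B C D r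
  have p1 : 0 < ((C + D : ℤ) : ℚ) / r := by positivity
  have p2 : ((C + D : ℤ) : ℚ) / r < 1 := by rw [div_lt_one hrq]; exact h1'
  rintro (h | ⟨i, h⟩)
  · rw [h] at hs
    rw [← hs] at p1
    simp at p1
  · rw [h] at hs
    rw [← hs] at p1 p2
    fin_cases i <;> simp at p1 p2

theorem step {r a b c d e j D A B : ℤ} {δ : ℝ} {S : Set (Fin 4 → ℕ)} {BB : Set (Fin 4 → ℚ)}
    (hr : 13 < r) (hδ : δ ≤ 1 / 100000) (hW : WeightCond r a b c d e S)
    (hI : RuleI r a b c d δ S BB) (hF : FormCA S) (hj : 1 ≤ j) (hjr : j < r) (hD : 0 ≤ D)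
    (hDj : D + j ≤ r) (hA : 0 ≤ A) (hA1 : A ≤ r - 1) (hB : 0 ≤ B) (hB1 : B ≤ r - 1)
    (ha : r ∣ A - (-j) * a) (hb : r ∣ B - (-j) * b) (hc : r ∣ (r - j - D) - (-j) * c)
    (hd : r ∣ D - (-j) * d) :
    (vec A B (r - j - D) D r ∈ BB ∧ 100000 * j ≤ r) ∨
    (vec A B (r - j - D) D r ∉ BB ∧
      ∃ P U : ℤ, 0 ≤ P ∧ 0 ≤ U ∧ 2 ≤ P + U ∧ P * (r - j - D) + U * D = A + B - r ∧
      r ∣ P * c + U * d - e) := by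
  have hr0 : 0 < r := by linarith
  have hrR : (0:ℝ) < (r : ℝ) := by exact_mod_cast hr0
  obtain ⟨hF1, hF2⟩ := hF
  have hne : S.Nonempty := ⟨_, hF1⟩
  obtain ⟨-, -, hI1, hI2⟩ := hI
  have hC : 0 ≤ r - j - D := by linarith
  have hmod : ∀ m ∈ S, r ∣ TT A B (r - j - D) D m - (A + B) := by
    have hm1 : ∀ m ∈ S, r ∣ TT A B (r - j - D) D m + j * e := by
      intro m hm
      obtain ⟨k, hk⟩ := (hW m hm).dvd
      obtain ⟨x, hx⟩ := ha
      obtain ⟨y, hy⟩ := hb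
      obtain ⟨z, hz⟩ := hc
      obtain ⟨t, ht⟩ := hd
      refine ⟨(m 0 : ℤ) * x + (m 1 : ℤ) * y + (m 2 : ℤ) * z + (m 3 : ℤ) * t + j * k, ?_⟩
      unfold TT
      linear_combination (m 0 : ℤ) * hx + (m 1 : ℤ) * hy + (m 2 : ℤ) * hz + (m 3 : ℤ) * ht + j * hk
    intro m hm
    have h1 := hm1 m hm
    have h2 := hm1 _ hF1
    have h3 := dvd_sub h1 h2
    have : TT A B (r - j - D) D ![1, 1, 0, 0] = A + B := by simp [TT]
    rw [this] at h3
    rwa [show TT A B (r - j - D) D m - (A + B) = TT A B (r - j - D) D m + j * e - (A + B + j * e) by ring]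
  by_cases hv : vec A B (r - j - D) D r ∈ BB
  · left
    refine ⟨hv, ?_⟩
    obtain ⟨-, q1, q2⟩ := hI1 _ hv
    rw [vec_w] at q1 q2
    obtain ⟨m, hm, hlt⟩ := vf_lt (x := ((A + B + (r - j - D) + D : ℤ) : ℝ) / r - 1 + δ) hne (by linarith)
    have hge := vf_le (S := S) (r := r) hr0 hA hB hC hD hm
    have g1 : ((A + B + (r - j - D) + D : ℤ) : ℝ) / r - 1 < (TT A B (r - j - D) D m : ℝ) / r := by
      linarith
    have g2 : ((A + B + (r - j - D) + D : ℤ) : ℝ) - r < (TT A B (r - j - D) D m : ℝ) := by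
      rw [lt_div_iff₀ hrR, sub_mul, div_mul_cancel₀ _ hrR.ne'] at g1
      linarith
    have g3 : (TT A B (r - j - D) D m : ℝ) < ((A + B + (r - j - D) + D : ℤ) : ℝ) - r + δ * r := by
      rw [div_lt_iff₀ hrR, add_mul, sub_mul, div_mul_cancel₀ _ hrR.ne'] at hlt
      linarith
    have g4 : A + B + (r - j - D) + D - r < TT A B (r - j - D) D m := by exact_mod_cast g2
    have g5 : δ * r ≤ 1 / 100000 * r := by nlinarith
    have g6 : 100000 * (TT A B (r - j - D) D m : ℝ) < 100000 * (((A + B + (r - j - D) + D : ℤ) : ℝ) - r) + r := by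
      linarith
    have g7 : 100000 * TT A B (r - j - D) D m < 100000 * (A + B + (r - j - D) + D - r) + r := by
      exact_mod_cast g6
    obtain ⟨k, hk⟩ := hmod m hm
    generalize TT A B (r - j - D) D m = T at *
    have : 0 ≤ k := by
      by_contra hcon
      have : k ≤ -1 := by omega
      nlinarith
    nlinarith
  · right
    refine ⟨hv, ?_⟩
    have q := hI2 _ (vec_mem (-j) hr0 hA hB hC hD ha hb hc hd) hv (vec_corner hr0 (by linarith) (by linarith))
    rw [vec_w] at q
    obtain ⟨m, hm, hlt⟩ := vf_lt (x := ((A + B + (r - j - D) + D : ℤ) : ℝ) / r - 1) hne (by linarith)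
    have g3 : (TT A B (r - j - D) D m : ℝ) < ((A + B + (r - j - D) + D : ℤ) : ℝ) - r := by
      rw [div_lt_iff₀ hrR, sub_mul, div_mul_cancel₀ _ hrR.ne'] at hlt
      linarith
    have g4 : TT A B (r - j - D) D m < A + B + (r - j - D) + D - r := by exact_mod_cast g3
    have hm11 : m ≠ ![1, 1, 0, 0] := by
      rintro rfl
      have : TT A B (r - j - D) D ![1, 1, 0, 0] = A + B := by simp [TT]
      linarith
    obtain ⟨m0, m1, m2⟩ := hF2 m hm hm11
    have hw := (hW m hm).symm.dvd
    have hT : TT A B (r - j - D) D m = (m 2 : ℤ) * (r - j - D) + (m 3 : ℤ) * D := by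
      simp [TT, m0, m1]
    obtain ⟨k, hk⟩ := hmod m hm
    refine ⟨m 2, m 3, by positivity, by positivity, by exact_mod_cast m2, ?_, ?_⟩
    · have hT0 : 0 ≤ TT A B (r - j - D) D m := by rw [hT]; positivity
      rw [← hT]
      generalize TT A B (r - j - D) D m = T at *
      have k1 : k < 0 := by
        by_contra hcon
        nlinarith
      have k2 : -2 < k := by
        by_contra hcon
        nlinarith
      have : k = -1 := by omega
      subst this
      linarith
    · simpa [m0, m1] using hw

theorem reduction {r a b c d e s : ℤ} {δ : ℝ} {S : Set (Fin 4 → ℕ)} {BB : Set (Fin 4 → ℚ)}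
    (hr : 13 < r) (hδ : δ ≤ 1 / 100000) (hW : WeightCond r a b c d e S)
    (hI : RuleI r a b c d δ S BB) (hF : FormCA S) (hab : r ∣ a + b - e)
    (hds : r ∣ d + s) (hcs : r ∣ c - 1 - s) :
    ∃ j0 : ℤ, (j0 = 0 ∨ (1 ≤ j0 ∧ 100000 * j0 ≤ r)) ∧ Cfg r s (-e) (-a) (-b) j0 := by
  have hr0 : 0 < r := by linarith
  let V : ℤ → Fin 4 → ℚ := fun j => vec ((-a * j) % r) ((-b * j) % r) (r - j - (j * s) % r) ((j * s) % r) r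
  have dv : ∀ x : ℤ, r ∣ x % r - x := fun x => ⟨-(x / r), by
    have := Int.emod_add_mul_ediv x r; linarith⟩
  have main : ∀ j, 1 ≤ j → j < r → (j * s) % r + j ≤ r →
      (V j ∈ BB ∧ 100000 * j ≤ r) ∨
      (V j ∉ BB ∧ ∃ P U : ℤ, 0 ≤ P ∧ 0 ≤ U ∧ 2 ≤ P + U ∧ P * (r - j - (j * s) % r) + U * ((j * s) % r)
        = (-a * j) % r + (-b * j) % r - r ∧ r ∣ P * c + U * d - e) := by
    intro j hj hjr hDj
    have e1 := Int.emod_lt_of_pos (-a * j) hr0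
    have e2 := Int.emod_lt_of_pos (-b * j) hr0
    have hd' : r ∣ (j * s) % r - (-j) * d := by
      have := dvd_add (dv (j * s)) (Dvd.dvd.mul_left hds j)
      rwa [show (j * s) % r - j * s + j * (d + s) = (j * s) % r - (-j) * d by ring] at this
    refine step hr hδ hW hI hF hj hjr (Int.emod_nonneg _ hr0.ne') hDj (Int.emod_nonneg _ hr0.ne')
      (by omega) (Int.emod_nonneg _ hr0.ne') (by omega) ?_ ?_ ?_ hd'
    · have := dv (-a * j)
      rwa [show -a * j = -j * a by ring] at *
    · have := dv (-b * j)
      rwa [show -b * j = -j * b by ring] at *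
    · have h3 := dvd_add (dvd_sub (Dvd.dvd.mul_left hcs j) (dv (j * s))) (dvd_refl r)
      rwa [show j * (c - 1 - s) - ((j * s) % r - j * s) + r = r - j - (j * s) % r - -j * c by ring] at h3
  have fin : ∀ j0 : ℤ, (∀ j, 1 ≤ j → j < r → (j * s) % r + j ≤ r → j ≠ j0 → V j ∉ BB) →
      Cfg r s (-e) (-a) (-b) j0 := by
    intro j0 hj0 j D E h1 h2 h3 h4 h5 h6 h7 h8 h9
    have hDe : (j * s) % r = D := by
      obtain ⟨k, hk⟩ := h6
      exact emod_of (-k) (by linarith) h4 (by linarith)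
    rw [← hDe] at h5 ⊢
    rcases main j h1 h2 h5 with ⟨h, -⟩ | ⟨-, P, U, hP, hU, hPU, hT, hdv⟩
    · exact absurd h (hj0 j h1 h2 h5 h3)
    have hE : E = (-a * j) % r + (-b * j) % r - r := by
      have e1 := Int.emod_lt_of_pos (-a * j) hr0
      have e2 := Int.emod_lt_of_pos (-b * j) hr0
      have hT0 : 0 ≤ (-a * j) % r + (-b * j) % r - r := by
        rw [← hT]
        exact add_nonneg (mul_nonneg hP (by linarith)) (mul_nonneg hU (Int.emod_nonneg _ hr0.ne'))
      obtain ⟨x, hx⟩ := dv (-a * j)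
      obtain ⟨y, hy⟩ := dv (-b * j)
      obtain ⟨z, hz⟩ := h9
      obtain ⟨t, ht⟩ := hab
      have key : r * (z - x - y + 1 + j * t) = E - ((-a * j) % r + (-b * j) % r - r) := by
        linear_combination -hz + hx + hy - j * ht
      have h0 := small_mul key (by linarith) (by linarith)
      rw [h0] at key
      linarith
    refine ⟨⟨P, U, hP, hU, hPU, by rw [hT, hE], ?_⟩, by linarith⟩
    have := dvd_add (dvd_sub hdv (Dvd.dvd.mul_left hcs P)) (Dvd.dvd.mul_left hds (-U))
    rwa [show P * c + U * d - e - P * (c - 1 - s) + -U * (d + s) = P * (1 + s) - U * s + -e by ring] at this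
  by_cases hex : ∃ j, 1 ≤ j ∧ j < r ∧ (j * s) % r + j ≤ r ∧ V j ∈ BB
  · obtain ⟨j0, g1, g2, g3, g4⟩ := hex
    rcases main j0 g1 g2 g3 with ⟨-, h⟩ | h
    · refine ⟨j0, Or.inr ⟨g1, h⟩, fin j0 ?_⟩
      intro j h1 h2 h3 h4 h5
      have heq : V j = V j0 := hI.1 h5 g4
      have q1 := vec_cd ((-a * j) % r) ((-b * j) % r) (r - j - (j * s) % r) ((j * s) % r) r
      have q2 := vec_cd ((-a * j0) % r) ((-b * j0) % r) (r - j0 - (j0 * s) % r) ((j0 * s) % r) r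
      have q3 : V j 2 + V j 3 = V j0 2 + V j0 3 := by rw [heq]
      simp only [V] at q3
      rw [q1, q2] at q3
      have hrq : (r : ℚ) ≠ 0 := by exact_mod_cast hr0.ne'
      have q4 := (div_left_inj' hrq).1 q3
      have q5 : r - j - (j * s) % r + (j * s) % r = r - j0 - (j0 * s) % r + (j0 * s) % r := by
        exact_mod_cast q4
      apply h4
      linarith
    · exact absurd g4 h.1
  · push Not at hex
    exact ⟨0, Or.inl rfl, fin 0 (fun j h1 h2 h3 _ => hex j h1 h2 h3)⟩

theorem dvd_e_of {r d e : ℤ} (hd : r ∣ d) (h : Int.gcd d r ∣ Int.gcd e r) : r ∣ e := by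
  have h1 : r ∣ (Int.gcd d r : ℤ) := Int.dvd_coe_gcd hd dvd_rfl
  exact h1.trans ((Int.natCast_dvd_natCast.2 h).trans (Int.gcd_dvd_left ..))

/-- Exclusion of the types (B), (C), (D) in the cA case: the type must be
`(1/r)(a, -a, 1, 0; 0)` up to interchanging `z` and `t`. -/
theorem statement15 :
    ∃ δstar : ℝ, 0 < δstar ∧ δstar ≤ 1 / 13 ∧
      ∀ (r : ℤ) (δ : ℝ) (a b c d e : ℤ) (S : Set (Fin 4 → ℕ)) (B : Set (Fin 4 → ℚ)),
        13 < r → 0 < δ → δ ≤ δstar →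
        WeightCond r a b c d e S → RuleI r a b c d δ S B → RuleII r a b c d e →
        FormCA S →
        Int.ModEq r (a + b) 0 ∧ Int.ModEq r e 0 ∧
          ((Int.ModEq r c 1 ∧ Int.ModEq r d 0) ∨
            (Int.ModEq r c 0 ∧ Int.ModEq r d 1)) := by
  refine ⟨1 / 100000, by norm_num, by norm_num, ?_⟩
  intro r δ a b c d e S B hr _ hδ hW hI hII hF
  have hr0 : 0 < r := by linarith
  have hab : r ∣ a + b - e := by
    have := (hW _ hF.1).symm.dvd
    simpa using this
  obtain ⟨-, -, hgc, hgd, -, -, -, -, -, -, h1⟩ := hII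
  have hcd : r ∣ c + d - 1 := by
    have h2 := dvd_sub h1.symm.dvd hab
    rwa [show a + b + c + d - e - 1 - (a + b - e) = c + d - 1 by ring] at h2
  have conv : ∀ x y : ℤ, r ∣ x - y → Int.ModEq r x y := fun x y h =>
    (Int.modEq_iff_dvd.2 h).symm
  have ab0 : r ∣ e → Int.ModEq r (a + b) 0 := fun h => conv _ _ (by
    have := dvd_add hab h
    simpa using this)
  by_cases hd0 : r ∣ d
  · have he := dvd_e_of hd0 hgd
    refine ⟨ab0 he, conv _ _ (by simpa using he), Or.inl ⟨conv _ _ ?_, conv _ _ (by simpa using hd0)⟩⟩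
    have := dvd_sub hcd hd0
    rwa [show c + d - 1 - d = c - 1 by ring] at this
  by_cases hc0 : r ∣ c
  · have he := dvd_e_of hc0 hgc
    refine ⟨ab0 he, conv _ _ (by simpa using he), Or.inr ⟨conv _ _ (by simpa using hc0), conv _ _ ?_⟩⟩
    have := dvd_sub hcd hc0
    rwa [show c + d - 1 - c = d - 1 by ring] at this
  exfalso
  have s0 := Int.emod_nonneg (-d) hr0.ne'
  have s1 := Int.emod_lt_of_pos (-d) hr0
  have hds : r ∣ d + (-d) % r := ⟨-(-d / r), by
    have := Int.emod_add_mul_ediv (-d) r; linarith⟩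
  generalize (-d) % r = s at *
  have hcs : r ∣ c - 1 - s := by
    have := dvd_sub hcd hds
    rwa [show c + d - 1 - (d + s) = c - 1 - s by ring] at this
  have hs1 : 1 ≤ s := by
    by_contra hcon
    obtain rfl : s = 0 := by omega
    exact hd0 (by simpa using hds)
  have hs2 : s ≤ r - 2 := by
    by_contra hcon
    obtain rfl : s = r - 1 := by omega
    apply hc0
    have := dvd_add hcs (dvd_refl r)
    rwa [show c - 1 - (r - 1) + r = c by ring] at this
  obtain ⟨j0, hj0, hcfg⟩ := reduction hr hδ hW hI hF hab hds hcs
  exact core_s15 hcfg hr hs1 hs2 hj0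

end GapPaper
end
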